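/- There exists a constant C > 0, depending only on ν and μ, such that for every u₀ in the Schwartz class on ℝ one has ‖D_x^{−1/4} S(t) P^a u₀‖_{L⁴_x L^∞_t} ≤ C ‖u₀‖_{L²(ℝ)}. (Maximal function estimate for the Benjamin group, Lemma 2.1, estimate (2.3).) -/

import Mathlib

open MeasureTheory Real
open scoped ENNReal NNReal Classical

noncomputable section

/-- Phase function of the linear Benjamin equation: `φ(ξ) = -ν ξ|ξ| + μ ξ³`. -/
def phase (ν μ ξ : ℝ) : ℝ := -ν * ξ * |ξ| + μ * ξ ^ 3

/-- Derivative of the phase: `φ'(ξ) = -2ν|ξ| + 3μξ²`. -/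
def dphase (ν μ ξ : ℝ) : ℝ := -2 * ν * |ξ| + 3 * μ * ξ ^ 2

/-- The frequency threshold `a = 2·max(1, |2ν/(3μ)|)`. -/
def aconst (ν μ : ℝ) : ℝ := 2 * max 1 |2 * ν / (3 * μ)|

/-- Fourier transform in the space variable. -/
def FT (f : ℝ → ℂ) (ξ : ℝ) : ℂ := ∫ x : ℝ, Complex.exp (-(Complex.I * ξ * x)) * f x

/-- Space-time Fourier transform. -/
def FT2 (u : ℝ → ℝ → ℂ) (ξ τ : ℝ) : ℂ :=
  ∫ x : ℝ, ∫ t : ℝ, Complex.exp (-(Complex.I * (ξ * x + τ * t))) * u x t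

/-- Mixed norm `‖f‖_{L^p_x L^q_t}` (with exponents in `ℝ≥0∞`). -/
def mixedLpLq (p q : ℝ≥0∞) (f : ℝ → ℝ → ℂ) : ℝ≥0∞ :=
  if p = ∞ then essSup (fun x => eLpNorm (f x) q volume) volume
  else (∫⁻ x : ℝ, eLpNorm (f x) q volume ^ p.toReal) ^ (1 / p.toReal)

/-- The Bourgain norm `‖u‖_{X_{s,b}}` associated to the Benjamin phase function. -/
def XNorm (ν μ s b : ℝ) (u : ℝ → ℝ → ℂ) : ℝ≥0∞ :=
  (∫⁻ ξ : ℝ, ∫⁻ τ : ℝ,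
      ENNReal.ofReal ((1 + ξ ^ 2) ^ s * (1 + (τ - phase ν μ ξ) ^ 2) ^ b) *
        (‖FT2 u ξ τ‖₊ : ℝ≥0∞) ^ 2) ^ (1 / 2 : ℝ)

/-- The free Benjamin group `S(t)` applied to initial data `u₀`, as a function of `(x,t)`. -/
def Sgrp (ν μ : ℝ) (u₀ : ℝ → ℂ) (x t : ℝ) : ℂ :=
  (2 * π)⁻¹ • ∫ ξ : ℝ, Complex.exp (Complex.I * (ξ * x + phase ν μ ξ * t)) * FT u₀ ξ

/-- `D_x^α S(t) P^a u₀` : the Benjamin group composed with the Fourier restriction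
`P^a` to `{|ξ| ≥ a}` and the derivative operator `D_x^α`. -/
def DSgrpPa (ν μ α : ℝ) (u₀ : ℝ → ℂ) (x t : ℝ) : ℂ :=
  (2 * π)⁻¹ • ∫ ξ : ℝ,
    if aconst ν μ ≤ |ξ| then
      (↑(|ξ| ^ α) : ℂ) * Complex.exp (Complex.I * (ξ * x + phase ν μ ξ * t)) * FT u₀ ξ
    else 0

/-- `D_x^α P^a F` acting in the space variable of a space-time function `F`. -/
def DPa (ν μ α : ℝ) (F : ℝ → ℝ → ℂ) (x t : ℝ) : ℂ :=
  (2 * π)⁻¹ • ∫ ξ : ℝ,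
    if aconst ν μ ≤ |ξ| then
      (↑(|ξ| ^ α) : ℂ) * Complex.exp (Complex.I * (ξ * x)) * FT (fun y => F y t) ξ
    else 0

/-- First derivative van der Corput bound with a decreasing weight, convex phase. -/
lemma norm_integral_exp_mul_le_of_deriv {ψ p q w w' : ℝ → ℝ} {α β l : ℝ} (hαβ : α ≤ β)
    (hψ : ∀ x ∈ Set.Icc α β, HasDerivAt ψ (p x) x)
    (hp : ∀ x ∈ Set.Icc α β, HasDerivAt p (q x) x)
    (hw : ∀ x ∈ Set.Icc α β, HasDerivAt w (w' x) x)
    (hq : ContinuousOn q (Set.Icc α β)) (hw' : ContinuousOn w' (Set.Icc α β))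
    (hq0 : ∀ x ∈ Set.Icc α β, 0 ≤ q x) (hw'0 : ∀ x ∈ Set.Icc α β, w' x ≤ 0)
    (hw0 : ∀ x ∈ Set.Icc α β, 0 ≤ w x) (hwα : ∀ x ∈ Set.Icc α β, w x ≤ w α)
    (hl : 0 < l) (hpl : ∀ x ∈ Set.Icc α β, l ≤ |p x|) :
    ‖∫ x in α..β, Complex.exp (Complex.I * ψ x) * (w x : ℂ)‖ ≤ 5 * (w α / l) := by
  have hp0 : ∀ x ∈ Set.Icc α β, p x ≠ 0 := fun x hx h => by
    have := hpl x hx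
    rw [h, abs_zero] at this
    linarith
  have hψc : ContinuousOn ψ (Set.Icc α β) := fun x hx => (hψ x hx).continuousAt.continuousWithinAt
  have hpc : ContinuousOn p (Set.Icc α β) := fun x hx => (hp x hx).continuousAt.continuousWithinAt
  have hwc : ContinuousOn w (Set.Icc α β) := fun x hx => (hw x hx).continuousAt.continuousWithinAt
  have hαm : α ∈ Set.Icc α β := ⟨le_refl _, hαβ⟩
  have hβm : β ∈ Set.Icc α β := ⟨hαβ, le_refl _⟩
  have huI : Set.uIcc α β = Set.Icc α β := Set.uIcc_of_le hαβ
  have hexpc : ContinuousOn (fun x => Complex.exp (Complex.I * ψ x)) (Set.Icc α β) := by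
    have : ContinuousOn (fun x => (ψ x : ℂ)) (Set.Icc α β) :=
      Complex.continuous_ofReal.comp_continuousOn hψc
    fun_prop
  have hg : ∀ x ∈ Set.Icc α β, HasDerivAt (fun y => w y / p y)
      ((w' x * p x - w x * q x) / p x ^ 2) x := fun x hx => (hw x hx).div (hp x hx) (hp0 x hx)
  have hgc : ContinuousOn (fun x => (w' x * p x - w x * q x) / p x ^ 2) (Set.Icc α β) :=
    ((hw'.mul hpc).sub (hwc.mul hq)).div (hpc.pow 2) fun x hx => pow_ne_zero 2 (hp0 x hx)
  have hnorm : ∀ y : ℝ, ‖Complex.exp (Complex.I * y)‖ = 1 := fun y => by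
    rw [mul_comm]; exact Complex.norm_exp_ofReal_mul_I y
  set R : ℝ → ℂ := fun x => Complex.I * (Complex.exp (Complex.I * ψ x) *
    (((w' x * p x - w x * q x) / p x ^ 2 : ℝ) : ℂ)) with hR
  have hRc : ContinuousOn R (Set.Icc α β) := by
    have : ContinuousOn (fun x => (((w' x * p x - w x * q x) / p x ^ 2 : ℝ) : ℂ)) (Set.Icc α β) :=
      Complex.continuous_ofReal.comp_continuousOn hgc
    exact continuousOn_const.mul (hexpc.mul this)
  have hmain : ContinuousOn (fun x => Complex.exp (Complex.I * ψ x) * (w x : ℂ))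
      (Set.Icc α β) := hexpc.mul (Complex.continuous_ofReal.comp_continuousOn hwc)
  set G : ℝ → ℂ := fun x => -Complex.I * (Complex.exp (Complex.I * ψ x) * ((w x / p x : ℝ) : ℂ))
    with hG
  have hGd : ∀ x ∈ Set.uIcc α β, HasDerivAt G
      (Complex.exp (Complex.I * ψ x) * (w x : ℂ) - R x) x := by
    intro x hx
    rw [huI] at hx
    have h1 := (((hψ x hx).ofReal_comp.const_mul Complex.I).cexp).mul (hg x hx).ofReal_comp
    have h2 := h1.const_mul (-Complex.I)
    have hpw : (p x : ℂ) * ((w x / p x : ℝ) : ℂ) = w x := by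
      rw [← Complex.ofReal_mul, mul_div_cancel₀ _ (hp0 x hx)]
    have hval : Complex.exp (Complex.I * ψ x) * (w x : ℂ) - R x = -Complex.I *
        (Complex.exp (Complex.I * ψ x) * (Complex.I * (p x : ℂ)) * ((w x / p x : ℝ) : ℂ) +
        Complex.exp (Complex.I * ψ x) * (((w' x * p x - w x * q x) / p x ^ 2 : ℝ) : ℂ)) := by
      simp only [hR]
      rw [← hpw]
      linear_combination (Complex.exp (Complex.I * ψ x) * (p x) * ((w x / p x : ℝ) : ℂ)) *
        Complex.I_sq
    rw [hval]
    exact h2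
  have hint1 : IntervalIntegrable (fun x => Complex.exp (Complex.I * ψ x) * (w x : ℂ))
      volume α β := by
    apply ContinuousOn.intervalIntegrable; rwa [huI]
  have hint2 : IntervalIntegrable R volume α β := by
    apply ContinuousOn.intervalIntegrable; rwa [huI]
  have hFTC := intervalIntegral.integral_eq_sub_of_hasDerivAt hGd (hint1.sub hint2)
  rw [intervalIntegral.integral_sub hint1 hint2] at hFTC
  have heq : ∫ x in α..β, Complex.exp (Complex.I * ψ x) * (w x : ℂ)
      = G β - G α + ∫ x in α..β, R x := by rw [← hFTC]; ring
  have hGle : ∀ x ∈ Set.Icc α β, ‖G x‖ ≤ w α / l := by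
    intro x hx
    simp only [hG, norm_mul, norm_neg, Complex.norm_I, hnorm, one_mul, Complex.norm_real,
      Real.norm_eq_abs, abs_div, abs_of_nonneg (hw0 x hx)]
    exact div_le_div₀ (hw0 α hαm) (hwα x hx) hl (hpl x hx)
  have hinv : ∀ x ∈ Set.Icc α β, |(p x)⁻¹| ≤ l⁻¹ := fun x hx => by
    rw [abs_inv]; exact inv_anti₀ hl (hpl x hx)
  set H : ℝ → ℝ := fun x => -(w x) * l⁻¹ - w α * (p x)⁻¹ with hH
  set H' : ℝ → ℝ := fun x => -(w' x) * l⁻¹ - w α * (-(q x) / p x ^ 2) with hH'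
  have hHd : ∀ x ∈ Set.uIcc α β, HasDerivAt H (H' x) x := by
    intro x hx
    rw [huI] at hx
    exact ((hw x hx).neg.mul_const _).sub (((hp x hx).inv (hp0 x hx)).const_mul _)
  have hH'i : IntervalIntegrable H' volume α β := by
    apply ContinuousOn.intervalIntegrable
    rw [huI]
    exact (hw'.neg.mul continuousOn_const).sub (continuousOn_const.mul
      (hq.neg.div (hpc.pow 2) fun x hx => pow_ne_zero 2 (hp0 x hx)))
  have hRH : ‖∫ x in α..β, R x‖ ≤ ∫ x in α..β, H' x := by
    apply intervalIntegral.norm_integral_le_of_norm_le hαβ _ hH'i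
    refine Filter.Eventually.of_forall fun x hx => ?_
    have hx' : x ∈ Set.Icc α β := Set.Ioc_subset_Icc_self hx
    simp only [hR, norm_mul, Complex.norm_I, hnorm, one_mul, Complex.norm_real, Real.norm_eq_abs]
    have e : (w' x * p x - w x * q x) / p x ^ 2 = w' x * (p x)⁻¹ - w x * (q x / p x ^ 2) := by
      have := hp0 x hx'
      field_simp
    rw [e]
    have hqp : 0 ≤ q x / p x ^ 2 := div_nonneg (hq0 x hx') (sq_nonneg _)
    calc |w' x * (p x)⁻¹ - w x * (q x / p x ^ 2)|
        ≤ |w' x * (p x)⁻¹| + |w x * (q x / p x ^ 2)| := abs_sub _ _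
      _ = -(w' x) * |(p x)⁻¹| + w x * (q x / p x ^ 2) := by
          rw [abs_mul, abs_of_nonpos (hw'0 x hx'), abs_of_nonneg (mul_nonneg (hw0 x hx') hqp)]
      _ ≤ -(w' x) * l⁻¹ + w α * (q x / p x ^ 2) := by
          gcongr
          · linarith [hw'0 x hx']
          · exact hinv x hx'
          · exact hwα x hx'
      _ = H' x := by simp only [hH']; ring
  rw [intervalIntegral.integral_eq_sub_of_hasDerivAt hHd hH'i] at hRH
  have hHb : H β - H α ≤ 3 * (w α / l) := by
    have h1 := abs_le.1 (hinv α hαm)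
    have h2 := abs_le.1 (hinv β hβm)
    have hwp := hw0 α hαm
    have hwb := mul_nonneg (hw0 β hβm) (inv_nonneg.2 hl.le)
    have h3 : w α * ((p α)⁻¹ - (p β)⁻¹) ≤ w α * (2 * l⁻¹) :=
      mul_le_mul_of_nonneg_left (by linarith) hwp
    simp only [hH]
    rw [div_eq_mul_inv]
    nlinarith
  rw [heq]
  calc ‖G β - G α + ∫ x in α..β, R x‖ ≤ ‖G β‖ + ‖G α‖ + ‖∫ x in α..β, R x‖ :=
        (norm_add_le _ _).trans (by gcongr; exact norm_sub_le _ _)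
    _ ≤ w α / l + w α / l + 3 * (w α / l) := by
        gcongr
        · exact hGle β hβm
        · exact hGle α hαm
        · exact hRH.trans hHb
    _ = 5 * (w α / l) := by ring

lemma exists_level_split {p : ℝ → ℝ} {α β : ℝ} (hαβ : α ≤ β)
    (hp : ContinuousOn p (Set.Icc α β)) (hm : MonotoneOn p (Set.Icc α β)) (y : ℝ) :
    ∃ c ∈ Set.Icc α β, (α < c → ∀ x ∈ Set.Icc α c, p x ≤ y) ∧
      (c < β → ∀ x ∈ Set.Icc c β, y ≤ p x) := by
  have hαm : α ∈ Set.Icc α β := ⟨le_refl _, hαβ⟩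
  have hβm : β ∈ Set.Icc α β := ⟨hαβ, le_refl _⟩
  rcases le_total y (p α) with h | h
  · exact ⟨α, hαm, fun h' => absurd h' (lt_irrefl _), fun _ x hx => h.trans (hm hαm hx hx.1)⟩
  rcases le_total (p β) y with h' | h'
  · exact ⟨β, hβm, fun _ x hx => (hm hx hβm hx.2).trans h', fun h' => absurd h' (lt_irrefl _)⟩
  obtain ⟨c, hc, hcy⟩ := intermediate_value_Icc hαβ hp ⟨h, h'⟩
  exact ⟨c, hc, fun _ x hx => hcy ▸ hm ⟨hx.1, hx.2.trans hc.2⟩ hc hx.2,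
    fun _ x hx => hcy ▸ hm hc ⟨hc.1.trans hx.1, hx.2⟩ hx.1⟩

/-- Localization of an oscillatory integral with convex phase to the part where the
derivative of the phase is at most `l`. -/
lemma exists_norm_integral_exp_mul_le_add {ψ p q w w' : ℝ → ℝ} {α β l : ℝ} (hαβ : α ≤ β)
    (hψ : ∀ x ∈ Set.Icc α β, HasDerivAt ψ (p x) x)
    (hp : ∀ x ∈ Set.Icc α β, HasDerivAt p (q x) x)
    (hw : ∀ x ∈ Set.Icc α β, HasDerivAt w (w' x) x)
    (hq : ContinuousOn q (Set.Icc α β)) (hw' : ContinuousOn w' (Set.Icc α β))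
    (hq0 : ∀ x ∈ Set.Icc α β, 0 ≤ q x) (hw'0 : ∀ x ∈ Set.Icc α β, w' x ≤ 0)
    (hw0 : ∀ x ∈ Set.Icc α β, 0 ≤ w x) (hwa : AntitoneOn w (Set.Icc α β))
    (hl : 0 < l) :
    ∃ c d, α ≤ c ∧ c ≤ d ∧ d ≤ β ∧ (c < d → ∀ x ∈ Set.Icc c d, |p x| ≤ l) ∧
      ‖∫ x in α..β, Complex.exp (Complex.I * ψ x) * (w x : ℂ)‖ ≤
        10 * (w α / l) + ‖∫ x in c..d, Complex.exp (Complex.I * ψ x) * (w x : ℂ)‖ := by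
  have hψc : ContinuousOn ψ (Set.Icc α β) := fun x hx => (hψ x hx).continuousAt.continuousWithinAt
  have hpc : ContinuousOn p (Set.Icc α β) := fun x hx => (hp x hx).continuousAt.continuousWithinAt
  have hwc : ContinuousOn w (Set.Icc α β) := fun x hx => (hw x hx).continuousAt.continuousWithinAt
  have hαm : α ∈ Set.Icc α β := ⟨le_refl _, hαβ⟩
  have hpm : MonotoneOn p (Set.Icc α β) := by
    apply monotoneOn_of_deriv_nonneg (convex_Icc _ _) hpc
    · exact fun x hx => (hp x (interior_subset hx)).differentiableAt.differentiableWithinAt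
    · intro x hx
      rw [(hp x (interior_subset hx)).deriv]
      exact hq0 x (interior_subset hx)
  obtain ⟨c, hc, hc1, hc2⟩ := exists_level_split hαβ hpc hpm (-l)
  have hsub : Set.Icc c β ⊆ Set.Icc α β := Set.Icc_subset_Icc_left hc.1
  obtain ⟨d, hd, hd1, hd2⟩ := exists_level_split hc.2 (hpc.mono hsub) (hpm.mono hsub) l
  have hf : ContinuousOn (fun x => Complex.exp (Complex.I * ψ x) * (w x : ℂ)) (Set.Icc α β) := by
    have h1 : ContinuousOn (fun x => (ψ x : ℂ)) (Set.Icc α β) :=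
      Complex.continuous_ofReal.comp_continuousOn hψc
    have h2 : ContinuousOn (fun x => (w x : ℂ)) (Set.Icc α β) :=
      Complex.continuous_ofReal.comp_continuousOn hwc
    fun_prop
  have hii : ∀ u v, α ≤ u → u ≤ v → v ≤ β →
      IntervalIntegrable (fun x => Complex.exp (Complex.I * ψ x) * (w x : ℂ)) volume u v := by
    intro u v hu huv hv
    apply ContinuousOn.intervalIntegrable
    rw [Set.uIcc_of_le huv]
    exact hf.mono (Set.Icc_subset_Icc hu hv)
  have key : ∀ u v, α ≤ u → u ≤ v → v ≤ β → (u < v → ∀ x ∈ Set.Icc u v, l ≤ |p x|) →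
      ‖∫ x in u..v, Complex.exp (Complex.I * ψ x) * (w x : ℂ)‖ ≤ 5 * (w α / l) := by
    intro u v hu huv hv hpl
    have hs : Set.Icc u v ⊆ Set.Icc α β := Set.Icc_subset_Icc hu hv
    have hum : u ∈ Set.Icc α β := ⟨hu, huv.trans hv⟩
    rcases huv.eq_or_lt with rfl | hlt
    · simp only [intervalIntegral.integral_same, norm_zero]
      have := hw0 α hαm
      positivity
    · refine (norm_integral_exp_mul_le_of_deriv huv (fun x hx => hψ x (hs hx))
        (fun x hx => hp x (hs hx)) (fun x hx => hw x (hs hx)) (hq.mono hs) (hw'.mono hs)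
        (fun x hx => hq0 x (hs hx)) (fun x hx => hw'0 x (hs hx)) (fun x hx => hw0 x (hs hx))
        (fun x hx => hwa hum (hs hx) hx.1) hl (hpl hlt)).trans ?_
      gcongr
      exact hwa hαm hum hu
  refine ⟨c, d, hc.1, hd.1, hd.2, fun hcd x hx => abs_le.2 ⟨?_, ?_⟩, ?_⟩
  · exact hc2 (hcd.trans_le hd.2) x ⟨hx.1, hx.2.trans hd.2⟩
  · exact hd1 hcd x hx
  · have e1 := key α c le_rfl hc.1 hc.2 fun h x hx => by
      have := hc1 h x hx
      rw [abs_of_nonpos (by linarith)]; linarith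
    have e2 := key d β (hc.1.trans hd.1) hd.2 le_rfl fun h x hx =>
      (hd2 h x hx).trans (le_abs_self _)
    rw [← intervalIntegral.integral_add_adjacent_intervals
      (hii α c le_rfl hc.1 hc.2) (hii c β hc.1 hc.2 le_rfl),
      ← intervalIntegral.integral_add_adjacent_intervals
      (hii c d hc.1 hd.1 hd.2) (hii d β (hc.1.trans hd.1) hd.2 le_rfl)]
    refine (norm_add_le _ _).trans ?_
    have := norm_add_le (∫ x in c..d, Complex.exp (Complex.I * ψ x) * (w x : ℂ))
      (∫ x in d..β, Complex.exp (Complex.I * ψ x) * (w x : ℂ))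
    linarith

/-- Second derivative van der Corput bound with a decreasing weight. -/
lemma norm_integral_exp_mul_le_of_deriv2 {ψ p q w w' : ℝ → ℝ} {α β ρ : ℝ} (hαβ : α ≤ β)
    (hψ : ∀ x ∈ Set.Icc α β, HasDerivAt ψ (p x) x)
    (hp : ∀ x ∈ Set.Icc α β, HasDerivAt p (q x) x)
    (hw : ∀ x ∈ Set.Icc α β, HasDerivAt w (w' x) x)
    (hq : ContinuousOn q (Set.Icc α β)) (hw' : ContinuousOn w' (Set.Icc α β))
    (hρ : 0 < ρ) (hq0 : ∀ x ∈ Set.Icc α β, ρ ≤ q x) (hw'0 : ∀ x ∈ Set.Icc α β, w' x ≤ 0)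
    (hw0 : ∀ x ∈ Set.Icc α β, 0 ≤ w x) (hwa : AntitoneOn w (Set.Icc α β)) :
    ‖∫ x in α..β, Complex.exp (Complex.I * ψ x) * (w x : ℂ)‖ ≤ 12 * (w α / √ρ) := by
  have hρ' : 0 < √ρ := Real.sqrt_pos.2 hρ
  have hαm : α ∈ Set.Icc α β := ⟨le_refl _, hαβ⟩
  obtain ⟨c, d, h1, h2, h3, h4, h5⟩ := exists_norm_integral_exp_mul_le_add hαβ hψ hp hw hq hw'
    (fun x hx => hρ.le.trans (hq0 x hx)) hw'0 hw0 hwa hρ'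
  have hs : Set.Icc c d ⊆ Set.Icc α β := Set.Icc_subset_Icc h1 h3
  have hlen : d - c ≤ 2 / √ρ := by
    rcases h2.eq_or_lt with rfl | hlt
    · rw [sub_self]; positivity
    have hmvt := (convex_Icc c d).mul_sub_le_image_sub_of_le_deriv (f := p) (C := ρ)
      (fun x hx => (hp x (hs hx)).continuousAt.continuousWithinAt)
      (fun x hx => (hp x (hs (interior_subset hx))).differentiableAt.differentiableWithinAt)
      (fun x hx => by
        rw [(hp x (hs (interior_subset hx))).deriv]; exact hq0 x (hs (interior_subset hx)))
      c ⟨le_rfl, h2⟩ d ⟨h2, le_rfl⟩ h2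
    have a1 := abs_le.1 (h4 hlt c ⟨le_rfl, h2⟩)
    have a2 := abs_le.1 (h4 hlt d ⟨h2, le_rfl⟩)
    rw [le_div_iff₀ hρ']
    have hsq : √ρ * √ρ = ρ := Real.mul_self_sqrt hρ.le
    have : √ρ * ((d - c) * √ρ) ≤ √ρ * 2 := by
      calc √ρ * ((d - c) * √ρ) = (√ρ * √ρ) * (d - c) := by ring
        _ = ρ * (d - c) := by rw [hsq]
        _ ≤ √ρ * 2 := by linarith
    exact le_of_mul_le_mul_left this hρ'
  have hmid : ‖∫ x in c..d, Complex.exp (Complex.I * ψ x) * (w x : ℂ)‖ ≤ w α * |d - c| := by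
    apply intervalIntegral.norm_integral_le_of_norm_le_const
    intro x hx
    rw [Set.uIoc_of_le h2] at hx
    have hx' := hs (Set.Ioc_subset_Icc_self hx)
    rw [norm_mul, mul_comm Complex.I, Complex.norm_exp_ofReal_mul_I, one_mul, Complex.norm_real,
      Real.norm_eq_abs, abs_of_nonneg (hw0 x hx')]
    exact hwa hαm hx' hx'.1
  rw [abs_of_nonneg (by linarith)] at hmid
  have := mul_le_mul_of_nonneg_left hlen (hw0 α hαm)
  calc _ ≤ _ := h5
    _ ≤ 10 * (w α / √ρ) + w α * (2 / √ρ) := by linarith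
    _ = 12 * (w α / √ρ) := by ring

lemma rpow_neg_half_eq_inv_sqrt {x : ℝ} (hx : 0 ≤ x) : x ^ (-(1 / 2) : ℝ) = (√x)⁻¹ := by
  rw [Real.rpow_neg hx, Real.sqrt_eq_rpow]

lemma norm_integral_exp_mul_rpow_le (ψ : ℝ → ℝ) {a c : ℝ} (ha : 0 < a) (hac : a ≤ c) :
    ‖∫ ξ in a..c, Complex.exp (Complex.I * ψ ξ) * ((ξ ^ (-(1 / 2) : ℝ) : ℝ) : ℂ)‖ ≤ 2 * √c := by
  have hi : IntervalIntegrable (fun ξ : ℝ => ξ ^ (-(1 / 2) : ℝ)) volume a c :=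
    intervalIntegral.intervalIntegrable_rpow' (by norm_num)
  have h := intervalIntegral.norm_integral_le_of_norm_le (μ := volume)
    (f := fun ξ : ℝ => Complex.exp (Complex.I * ψ ξ) * ((ξ ^ (-(1 / 2) : ℝ) : ℝ) : ℂ))
    hac (Filter.Eventually.of_forall fun ξ hξ => ?_) hi
  · refine h.trans ?_
    rw [integral_rpow (Or.inl (by norm_num))]
    have : (-(1 / 2) + 1 : ℝ) = 1 / 2 := by norm_num
    rw [this, ← Real.sqrt_eq_rpow, ← Real.sqrt_eq_rpow]
    have := Real.sqrt_nonneg a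
    rw [div_le_iff₀ (by norm_num)]
    linarith
  · have : 0 < ξ := ha.trans hξ.1
    rw [norm_mul, mul_comm Complex.I, Complex.norm_exp_ofReal_mul_I, one_mul, Complex.norm_real,
      Real.norm_eq_abs, abs_of_nonneg (by positivity)]

/-- Decay of the oscillatory integral with cubic phase away from the degenerate frequencies,
uniformly in the coefficient `s` of the dispersive part. -/
lemma norm_integral_exp_cubic_le {a b s x N : ℝ} (ha : 0 < a) (hb : |b| ≤ 3 / 4 * a)
    (hs : 0 ≤ s) (hx : x ≠ 0) (hN : a ≤ N) :
    ‖∫ ξ in a..N, Complex.exp (Complex.I * ((x * ξ + s * (ξ ^ 3 - b * ξ ^ 2) : ℝ) : ℂ)) *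
      ((ξ ^ (-(1 / 2) : ℝ) : ℝ) : ℂ)‖ ≤ 52 * |x| ^ (-(1 / 2) : ℝ) := by
  have hx0 : 0 < |x| := abs_pos.2 hx
  have hsx : 0 < √|x| := Real.sqrt_pos.2 hx0
  rw [rpow_neg_half_eq_inv_sqrt hx0.le]
  set ψ : ℝ → ℝ := fun ξ => x * ξ + s * (ξ ^ 3 - b * ξ ^ 2) with hψ
  set p : ℝ → ℝ := fun ξ => x + s * (3 * ξ ^ 2 - b * (2 * ξ)) with hp
  set q : ℝ → ℝ := fun ξ => s * (6 * ξ - b * 2) with hq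
  set w : ℝ → ℝ := fun ξ => ξ ^ (-(1 / 2) : ℝ) with hw
  set w' : ℝ → ℝ := fun ξ => (-(1 / 2)) * ξ ^ (-(1 / 2) - 1 : ℝ) with hw'
  change ‖∫ ξ in a..N, Complex.exp (Complex.I * ψ ξ) * (w ξ : ℂ)‖ ≤ _
  have hsmall : ∀ c, a ≤ c → c ≤ |x|⁻¹ →
      ‖∫ ξ in a..c, Complex.exp (Complex.I * ψ ξ) * (w ξ : ℂ)‖ ≤ 2 * (√|x|)⁻¹ := by
    intro c hc hcx
    refine (norm_integral_exp_mul_rpow_le ψ ha hc).trans ?_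
    rw [← Real.sqrt_inv]
    gcongr
  rcases le_total N |x|⁻¹ with hNx | hNx
  · refine (hsmall N hN hNx).trans ?_
    gcongr
    norm_num
  have hdψ : ∀ ξ, HasDerivAt ψ (p ξ) ξ := by
    intro ξ
    have h := ((hasDerivAt_id ξ).const_mul x).add
      (((hasDerivAt_pow 3 ξ).sub ((hasDerivAt_pow 2 ξ).const_mul b)).const_mul s)
    refine HasDerivAt.congr_deriv h ?_
    simp [hp]
  have hdp : ∀ ξ, HasDerivAt p (q ξ) ξ := by
    intro ξ
    have h := (((((hasDerivAt_pow 2 ξ).const_mul 3).sub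
      (((hasDerivAt_id ξ).const_mul 2).const_mul b)).const_mul s).const_add x)
    refine HasDerivAt.congr_deriv h ?_
    simp only [hq]
    push_cast
    ring
  have hdw : ∀ ξ, 0 < ξ → HasDerivAt w (w' ξ) ξ := fun ξ hξ =>
    Real.hasDerivAt_rpow_const (Or.inl hξ.ne')
  have hqc : Continuous q := by fun_prop
  have hw'c : ∀ u v : ℝ, 0 < u → ContinuousOn w' (Set.Icc u v) := fun u v hu ξ hξ =>
    (continuousAt_const.mul (Real.continuousAt_rpow_const _ _
      (Or.inl (hu.trans_le hξ.1).ne'))).continuousWithinAt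
  have hw'0 : ∀ ξ, 0 < ξ → w' ξ ≤ 0 := fun ξ hξ => by
    have : 0 ≤ ξ ^ (-(1 / 2) - 1 : ℝ) := by positivity
    simp only [hw']; linarith
  have hw0 : ∀ ξ, 0 < ξ → 0 ≤ w ξ := fun ξ hξ => by simp only [hw]; positivity
  have hwa : ∀ u v : ℝ, 0 < u → AntitoneOn w (Set.Icc u v) := fun u v hu ξ hξ η hη h =>
    Real.rpow_le_rpow_of_nonpos (hu.trans_le hξ.1) h (by norm_num)
  have hb' := abs_le.1 hb
  have hq0 : ∀ ξ, a ≤ ξ → 0 ≤ q ξ := fun ξ hξ => mul_nonneg hs (by linarith)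
  set α := max a |x|⁻¹ with hα
  have haα : a ≤ α := le_max_left _ _
  have hxα : |x|⁻¹ ≤ α := le_max_right _ _
  have hαN : α ≤ N := max_le hN hNx
  have hα0 : 0 < α := ha.trans_le haα
  have hwα : w α ≤ √|x| := by
    simp only [hw]
    rw [rpow_neg_half_eq_inv_sqrt hα0.le]
    rw [inv_le_comm₀ (Real.sqrt_pos.2 hα0) hsx, ← Real.sqrt_inv]
    exact Real.sqrt_le_sqrt hxα
  have h1 : ‖∫ ξ in a..α, Complex.exp (Complex.I * ψ ξ) * (w ξ : ℂ)‖ ≤ 2 * (√|x|)⁻¹ := by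
    rcases le_total a |x|⁻¹ with h | h
    · exact hsmall α haα (by rw [hα, max_eq_right h])
    · rw [hα, max_eq_left h, intervalIntegral.integral_same, norm_zero]; positivity
  obtain ⟨c, d, hc, hcd, hd, hpl, h2⟩ := exists_norm_integral_exp_mul_le_add hαN
    (fun ξ _ => hdψ ξ) (fun ξ _ => hdp ξ) (fun ξ hξ => hdw ξ (hα0.trans_le hξ.1))
    hqc.continuousOn (hw'c α N hα0) (fun ξ hξ => hq0 ξ (haα.trans hξ.1))
    (fun ξ hξ => hw'0 ξ (hα0.trans_le hξ.1)) (fun ξ hξ => hw0 ξ (hα0.trans_le hξ.1))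
    (hwa α N hα0) (half_pos hx0)
  have h3 : w α / (|x| / 2) ≤ 2 * (√|x|)⁻¹ := by
    rw [div_le_iff₀ (half_pos hx0)]
    have : (√|x|)⁻¹ * |x| = √|x| := by
      rw [inv_mul_eq_iff_eq_mul₀ hsx.ne', Real.mul_self_sqrt hx0.le]
    linarith
  have h4 : ‖∫ ξ in c..d, Complex.exp (Complex.I * ψ ξ) * (w ξ : ℂ)‖ ≤ 30 * (√|x|)⁻¹ := by
    rcases hcd.eq_or_lt with rfl | hlt
    · rw [intervalIntegral.integral_same, norm_zero]; positivity
    have hc0 : 0 < c := hα0.trans_le hc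
    have hθ : ∀ ξ, c ≤ ξ → 3 / 2 * ξ ^ 2 ≤ 3 * ξ ^ 2 - b * (2 * ξ) ∧
        3 * ξ ^ 2 - b * (2 * ξ) ≤ 9 / 2 * ξ ^ 2 := by
      intro ξ hξ
      have : a ≤ ξ := haα.trans (hc.trans hξ)
      constructor <;> nlinarith
    have hpl' := hpl hlt
    have hxneg : x < 0 := by
      by_contra! hcon
      have hh := hpl' c ⟨le_rfl, hcd⟩
      have := mul_nonneg hs ((by positivity : (0:ℝ) ≤ 3 / 2 * c ^ 2).trans (hθ c le_rfl).1)
      have h' : |p c| = x + s * (3 * c ^ 2 - b * (2 * c)) := abs_of_nonneg (by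
        simp only [hp]; linarith)
      rw [h', abs_of_nonneg hcon] at hh
      rw [abs_of_nonneg hcon] at hx0
      linarith
    have habs : |x| = -x := abs_of_neg hxneg
    have hlow : ∀ ξ ∈ Set.Icc c d, |x| / 2 ≤ s * (3 * ξ ^ 2 - b * (2 * ξ)) ∧
        s * (3 * ξ ^ 2 - b * (2 * ξ)) ≤ 3 / 2 * |x| := by
      intro ξ hξ
      have := abs_le.1 (hpl' ξ hξ)
      simp only [hp] at this
      constructor <;> linarith [this.1, this.2]
    have hs0 : 0 < s := by
      rcases hs.eq_or_lt with h | h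
      · have := (hlow c ⟨le_rfl, hcd⟩).1
        rw [← h, zero_mul] at this
        linarith
      · exact h
    have hd3 : d ≤ 3 * c := by
      have e1 := (hlow c ⟨le_rfl, hcd⟩).1
      have e2 := (hlow d ⟨hcd, le_rfl⟩).2
      have e3 : s * (3 * d ^ 2 - b * (2 * d)) ≤ s * (3 * (3 * c ^ 2 - b * (2 * c))) := by linarith
      have e4 := le_of_mul_le_mul_left e3 hs0
      have e5 := (hθ c le_rfl).2
      have e6 := (hθ d hcd).1
      nlinarith
    have hρ : 0 < |x| / (6 * c) := by positivity
    have hqρ : ∀ ξ ∈ Set.Icc c d, |x| / (6 * c) ≤ q ξ := by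
      intro ξ hξ
      have hξ0 : 0 < ξ := hc0.trans_le hξ.1
      have e1 := (hlow ξ hξ).1
      rw [div_le_iff₀ (by positivity)]
      have e2 : ξ ≤ 3 * c := hξ.2.trans hd3
      have e3 : s * (3 * ξ ^ 2 - b * (2 * ξ)) ≤ q ξ * ξ := by
        simp only [hq]
        have := mul_nonneg hs (sq_nonneg ξ)
        nlinarith
      have e4 := mul_le_mul_of_nonneg_left e2 (hq0 ξ (haα.trans (hc.trans hξ.1)))
      linarith
    have h5 := norm_integral_exp_mul_le_of_deriv2 hcd
      (fun ξ _ => hdψ ξ) (fun ξ _ => hdp ξ) (fun ξ hξ => hdw ξ (hc0.trans_le hξ.1))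
      hqc.continuousOn (hw'c c d hc0) hρ hqρ
      (fun ξ hξ => hw'0 ξ (hc0.trans_le hξ.1)) (fun ξ hξ => hw0 ξ (hc0.trans_le hξ.1))
      (hwa c d hc0)
    refine h5.trans ?_
    have e1 : w c / √(|x| / (6 * c)) = (√(|x| / 6))⁻¹ := by
      simp only [hw]
      rw [rpow_neg_half_eq_inv_sqrt hc0.le, div_eq_mul_inv, ← mul_inv, ← Real.sqrt_mul hc0.le]
      congr 2
      field_simp
    have e2 : 2 / 5 * √|x| ≤ √(|x| / 6) := by
      apply Real.le_sqrt_of_sq_le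
      rw [mul_pow, Real.sq_sqrt hx0.le]
      linarith
    rw [e1]
    calc 12 * (√(|x| / 6))⁻¹ ≤ 12 * (2 / 5 * √|x|)⁻¹ := by gcongr
      _ = 30 * (√|x|)⁻¹ := by rw [mul_inv]; ring
  have hii : ∀ u v, a ≤ u → u ≤ v →
      IntervalIntegrable (fun ξ => Complex.exp (Complex.I * ψ ξ) * (w ξ : ℂ)) volume u v := by
    intro u v hu huv
    apply ContinuousOn.intervalIntegrable
    rw [Set.uIcc_of_le huv]
    have c1 : Continuous fun ξ => (ψ ξ : ℂ) :=
      Complex.continuous_ofReal.comp (by simp only [hψ]; fun_prop)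
    have c2 : ContinuousOn (fun ξ => (w ξ : ℂ)) (Set.Icc u v) := fun ξ hξ =>
      (Complex.continuous_ofReal.continuousAt.comp
        (hdw ξ (ha.trans_le (hu.trans hξ.1))).continuousAt).continuousWithinAt
    fun_prop
  rw [← intervalIntegral.integral_add_adjacent_intervals (hii a α le_rfl haα)
    (hii α N haα hαN)]
  refine (norm_add_le _ _).trans ?_
  linarith

lemma aconst_pos (ν μ : ℝ) : 0 < aconst ν μ := by
  unfold aconst
  have := le_max_left (1 : ℝ) |2 * ν / (3 * μ)|
  linarith

lemma norm_integral_exp_phase_Icc_le {ν μ x N : ℝ} (hμ : μ ≠ 0) (hx : x ≠ 0)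
    (hN : aconst ν μ ≤ N) (t : ℝ) :
    ‖∫ ξ in aconst ν μ..N, Complex.exp (Complex.I * (ξ * x + phase ν μ ξ * t)) *
      ((|ξ| ^ (-(1 / 2) : ℝ) : ℝ) : ℂ)‖ ≤ 52 * |x| ^ (-(1 / 2) : ℝ) := by
  have ha := aconst_pos ν μ
  have hb : |ν / μ| ≤ 3 / 4 * aconst ν μ := by
    have h := le_max_right (1 : ℝ) |2 * ν / (3 * μ)|
    have e : 2 * ν / (3 * μ) = 2 / 3 * (ν / μ) := by field_simp
    rw [e, abs_mul, abs_of_pos (by norm_num : (0 : ℝ) < 2 / 3)] at h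
    unfold aconst
    rw [e, abs_mul, abs_of_pos (by norm_num : (0 : ℝ) < 2 / 3)]
    linarith
  have hph : ∀ ξ, 0 < ξ → phase ν μ ξ = μ * (ξ ^ 3 - ν / μ * ξ ^ 2) := by
    intro ξ hξ
    unfold phase
    rw [abs_of_pos hξ]
    field_simp
    ring
  have hcongr : ∀ y r : ℝ, ∫ ξ in aconst ν μ..N, Complex.exp (Complex.I * (ξ * y +
      phase ν μ ξ * r)) * ((|ξ| ^ (-(1 / 2) : ℝ) : ℝ) : ℂ) = ∫ ξ in aconst ν μ..N,
      Complex.exp (Complex.I * ((y * ξ + (r * μ) * (ξ ^ 3 - ν / μ * ξ ^ 2) : ℝ) : ℂ)) *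
      ((ξ ^ (-(1 / 2) : ℝ) : ℝ) : ℂ) := by
    intro y r
    apply intervalIntegral.integral_congr
    intro ξ hξ
    rw [Set.uIcc_of_le hN] at hξ
    have hξ0 := ha.trans_le hξ.1
    simp only [hph ξ hξ0, abs_of_pos hξ0]
    congr 2
    push_cast
    ring
  rcases le_total 0 (t * μ) with h | h
  · rw [hcongr]
    exact norm_integral_exp_cubic_le ha hb h hx hN
  · have hneg := norm_integral_exp_cubic_le (s := (-t) * μ) (x := -x) ha hb (by linarith)
      (neg_ne_zero.2 hx) hN
    rw [← hcongr, abs_neg] at hneg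
    refine le_of_eq_of_le ?_ hneg
    rw [← RCLike.norm_conj, intervalIntegral.integral_of_le hN, intervalIntegral.integral_of_le hN,
      ← integral_conj]
    congr 1
    apply integral_congr_ae
    refine Filter.Eventually.of_forall fun ξ => ?_
    simp only [map_mul, ← Complex.exp_conj, map_add, Complex.conj_I, Complex.conj_ofReal]
    congr 2
    push_cast
    ring

/-- The frequency band `a ≤ |ξ| ≤ N`. -/
def band (ν μ N : ℝ) : Set ℝ := {ξ | aconst ν μ ≤ |ξ| ∧ |ξ| ≤ N}

lemma measurableSet_band (ν μ N : ℝ) : MeasurableSet (band ν μ N) :=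
  (measurableSet_le measurable_const measurable_norm).inter
    (measurableSet_le measurable_norm measurable_const)

/-- Dispersive decay of the kernel of `D_x^{-1/2} S(t) P^a` truncated to `|ξ| ≤ N`. -/
lemma norm_integral_band_le {ν μ x : ℝ} (hμ : μ ≠ 0) (hx : x ≠ 0) (N t : ℝ) :
    ‖∫ ξ in band ν μ N, Complex.exp (Complex.I * (ξ * x + phase ν μ ξ * t)) *
      ((|ξ| ^ (-(1 / 2) : ℝ) : ℝ) : ℂ)‖ ≤ 104 * |x| ^ (-(1 / 2) : ℝ) := by
  have ha := aconst_pos ν μ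
  rcases lt_or_ge N (aconst ν μ) with hN | hN
  · have : band ν μ N = ∅ := by
      ext ξ
      simp only [band, Set.mem_ofPred_eq, Set.mem_empty_iff_false, iff_false, not_and, not_le]
      exact fun h => hN.trans_le h
    rw [this, setIntegral_empty, norm_zero]
    positivity
  have hE : band ν μ N = Set.Icc (-N) (-aconst ν μ) ∪ Set.Icc (aconst ν μ) N := by
    ext ξ
    simp only [band, Set.mem_ofPred_eq, Set.mem_union, Set.mem_Icc]
    rcases le_total 0 ξ with h | h
    · rw [abs_of_nonneg h]
      constructor
      · exact fun h => Or.inr h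
      · rintro (h' | h')
        · linarith
        · exact h'
    · rw [abs_of_nonpos h]
      constructor
      · exact fun h' => Or.inl ⟨by linarith, by linarith⟩
      · rintro (h' | h')
        · exact ⟨by linarith, by linarith⟩
        · linarith
  set f : ℝ → ℂ := fun ξ => Complex.exp (Complex.I * (ξ * x + phase ν μ ξ * t)) *
      ((|ξ| ^ (-(1 / 2) : ℝ) : ℝ) : ℂ) with hf
  have hfc : ∀ S : Set ℝ, (∀ ξ ∈ S, ξ ≠ 0) → ContinuousOn f S := by
    intro S hS
    have c1 : Continuous fun ξ => (phase ν μ ξ : ℂ) := by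
      unfold phase; fun_prop
    have c2 : ContinuousOn (fun ξ : ℝ => ((|ξ| ^ (-(1 / 2) : ℝ) : ℝ) : ℂ)) S :=
      Complex.continuous_ofReal.comp_continuousOn
        (continuous_abs.continuousOn.rpow_const fun ξ hξ => Or.inl (abs_ne_zero.2 (hS ξ hξ)))
    fun_prop
  have i1 : IntegrableOn f (Set.Icc (-N) (-aconst ν μ)) :=
    (hfc _ fun ξ hξ => by have := hξ.2; intro h; linarith).integrableOn_Icc
  have i2 : IntegrableOn f (Set.Icc (aconst ν μ) N) :=
    (hfc _ fun ξ hξ => by have := hξ.1; intro h; linarith).integrableOn_Icc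
  rw [hE, setIntegral_union _ measurableSet_Icc i1 i2]
  · have e2 : ∫ ξ in Set.Icc (aconst ν μ) N, f ξ = ∫ ξ in aconst ν μ..N, f ξ := by
      rw [intervalIntegral.integral_of_le hN, integral_Icc_eq_integral_Ioc]
    have e1 : ∫ ξ in Set.Icc (-N) (-aconst ν μ), f ξ = ∫ ξ in aconst ν μ..N, f (-ξ) := by
      rw [intervalIntegral.integral_comp_neg (fun ξ => f ξ),
        intervalIntegral.integral_of_le (by linarith), integral_Icc_eq_integral_Ioc]
    have e3 : ∫ ξ in aconst ν μ..N, f (-ξ) = ∫ ξ in aconst ν μ..N,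
        Complex.exp (Complex.I * (ξ * (-x : ℝ) + phase ν μ ξ * (-t : ℝ))) *
          ((|ξ| ^ (-(1 / 2) : ℝ) : ℝ) : ℂ) := by
      congr 1
      ext ξ
      have : phase ν μ (-ξ) = -phase ν μ ξ := by unfold phase; rw [abs_neg]; ring
      simp only [hf, this, abs_neg]
      congr 2
      push_cast
      ring
    have b1 := norm_integral_exp_phase_Icc_le hμ (neg_ne_zero.2 hx) hN (-t)
    have b2 := norm_integral_exp_phase_Icc_le hμ hx hN t
    rw [abs_neg] at b1
    rw [e1, e2, e3]
    refine (norm_add_le _ _).trans ?_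
    linarith
  · rw [Set.disjoint_left]
    intro ξ h1 h2
    linarith [h1.2, h2.1]

lemma lintegral_min_pow_three_mul_rpow_le {h : ℝ → ℝ} (hm : Measurable h) (h0 : ∀ x, 0 ≤ h x)
    {B κ : ℝ} (hB : 0 < B) (hκ : 0 < κ)
    (hh : ∫⁻ x, ENNReal.ofReal (h x ^ 4) ≤ ENNReal.ofReal (B ^ 2)) (x : ℝ) :
    ∫⁻ y, ENNReal.ofReal (min (h y) κ ^ 3 * |x - y| ^ (-(1 / 2) : ℝ)) ≤
      ENNReal.ofReal (7 * B * κ) := by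
  set r : ℝ := B ^ 2 / κ ^ 4 with hr
  have hr0 : 0 < r := by positivity
  set s : ℝ := κ / B with hs
  have hs0 : 0 < s := by positivity
  set f : ℝ → ℝ := fun u => if u ≤ r then κ ^ 3 * u ^ (-(1 / 2) : ℝ)
    else (s ^ 3)⁻¹ * u ^ (-2 : ℝ) with hf
  have hpt : ∀ y, min (h y) κ ^ 3 * |x - y| ^ (-(1 / 2) : ℝ) ≤ s * h y ^ 4 + f |x - y| := by
    intro y
    have hmin0 : 0 ≤ min (h y) κ := le_min (h0 y) hκ.le
    have hsh : 0 ≤ s * h y ^ 4 := by have := h0 y; positivity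
    simp only [hf]
    set k : ℝ := |x - y| ^ (-(1 / 2) : ℝ) with hk
    have hk0 : 0 ≤ k := by positivity
    split_ifs with hu
    · have : min (h y) κ ^ 3 * k ≤ κ ^ 3 * k := by
        gcongr
        exact min_le_right _ _
      linarith
    · have hk4 : |x - y| ^ (-2 : ℝ) = k ^ 4 := by
        rw [hk, ← Real.rpow_natCast, ← Real.rpow_mul (abs_nonneg _)]
        norm_num
      rw [hk4]
      have h1 : min (h y) κ ^ 3 * k ≤ h y ^ 3 * k := by
        gcongr
        exact min_le_left _ _
      have hy := h0 y
      have h2 : 0 ≤ (s ^ 3)⁻¹ * k ^ 4 := by positivity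
      rcases le_total k (s * h y) with hc | hc
      · have : h y ^ 3 * k ≤ h y ^ 3 * (s * h y) := by gcongr
        nlinarith
      · have : s ^ 3 * (h y ^ 3 * k) ≤ k ^ 4 := by
          calc s ^ 3 * (h y ^ 3 * k) = (s * h y) ^ 3 * k := by ring
            _ ≤ k ^ 3 * k := by gcongr
            _ = k ^ 4 := by ring
        have : h y ^ 3 * k ≤ (s ^ 3)⁻¹ * k ^ 4 := by
          rw [inv_mul_eq_div, le_div_iff₀ (by positivity)]
          linarith
        linarith
  have hf0 : ∀ u, 0 ≤ u → 0 ≤ f u := by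
    intro u hu
    simp only [hf]
    split_ifs <;> positivity
  have i1 : IntegrableOn f (Set.Ioc 0 r) := by
    have : IntegrableOn (fun u : ℝ => κ ^ 3 * u ^ (-(1 / 2) : ℝ)) (Set.Ioc 0 r) :=
      ((intervalIntegral.intervalIntegrable_rpow' (a := 0) (b := r) (by norm_num)).1).const_mul _
    refine this.congr_fun (fun u hu => ?_) measurableSet_Ioc
    simp only [hf, if_pos hu.2]
  have i2 : IntegrableOn f (Set.Ioi r) := by
    have : IntegrableOn (fun u : ℝ => (s ^ 3)⁻¹ * u ^ (-2 : ℝ)) (Set.Ioi r) :=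
      (integrableOn_Ioi_rpow_of_lt (by norm_num) hr0).const_mul _
    refine this.congr_fun (fun u hu => ?_) measurableSet_Ioi
    simp only [hf, if_neg (not_le.2 (Set.mem_Ioi.1 hu))]
  have hun : Set.Ioi (0 : ℝ) = Set.Ioc 0 r ∪ Set.Ioi r := (Set.Ioc_union_Ioi_eq_Ioi hr0.le).symm
  have i3 : IntegrableOn f (Set.Ioi 0) := by rw [hun]; exact i1.union i2
  have v3 : ∫ u in Set.Ioi 0, f u = 2 * κ * B + κ * B := by
    rw [hun, setIntegral_union (Set.Ioc_disjoint_Ioi le_rfl) measurableSet_Ioi i1 i2]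
    congr 1
    · rw [setIntegral_congr_fun (g := fun u => κ ^ 3 * u ^ (-(1 / 2) : ℝ)) measurableSet_Ioc
        (fun u hu => by simp only [hf, if_pos hu.2]),
        ← intervalIntegral.integral_of_le hr0.le, intervalIntegral.integral_const_mul,
        integral_rpow (Or.inl (by norm_num))]
      have e : (-(1 / 2) + 1 : ℝ) = 1 / 2 := by norm_num
      have e2 : √r = B / κ ^ 2 := by
        rw [hr, Real.sqrt_div' _ (by positivity), Real.sqrt_sq hB.le,
          show κ ^ 4 = (κ ^ 2) ^ 2 by ring, Real.sqrt_sq (by positivity)]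
      rw [e, ← Real.sqrt_eq_rpow, ← Real.sqrt_eq_rpow, Real.sqrt_zero, e2]
      field_simp
      ring
    · rw [setIntegral_congr_fun (g := fun u => (s ^ 3)⁻¹ * u ^ (-2 : ℝ)) measurableSet_Ioi
        (fun u hu => by simp only [hf, if_neg (not_le.2 (Set.mem_Ioi.1 hu))]), integral_const_mul,
        integral_Ioi_rpow_of_lt (by norm_num) hr0]
      have e : (-2 + 1 : ℝ) = -1 := by norm_num
      rw [e, Real.rpow_neg_one, hr, hs]
      field_simp
  have i4 : Integrable fun u : ℝ => f |u| := by
    have h1 : IntegrableOn (fun u : ℝ => f |u|) (Set.Ioi 0) :=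
      i3.congr_fun (fun u hu => by rw [abs_of_pos (Set.mem_Ioi.1 hu)]) measurableSet_Ioi
    have h2 : IntegrableOn (fun u : ℝ => f |u|) (Set.Iic 0) := by
      rw [integrableOn_Iic_iff_integrableOn_Iio]
      have := h1.comp_neg
      simpa using this
    rw [← integrableOn_univ, ← Set.Iic_union_Ioi (a := (0 : ℝ))]
    exact h2.union h1
  have v4 : ∫⁻ u : ℝ, ENNReal.ofReal (f |u|) = ENNReal.ofReal (6 * κ * B) := by
    rw [← ofReal_integral_eq_lintegral_ofReal i4
      (Filter.Eventually.of_forall fun u => hf0 _ (abs_nonneg u)), integral_comp_abs, v3]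
    congr 1
    ring
  calc ∫⁻ y, ENNReal.ofReal (min (h y) κ ^ 3 * |x - y| ^ (-(1 / 2) : ℝ))
      ≤ ∫⁻ y, (ENNReal.ofReal s * ENNReal.ofReal (h y ^ 4) + ENNReal.ofReal (f |x - y|)) := by
        refine lintegral_mono fun y => ?_
        rw [← ENNReal.ofReal_mul hs0.le, ← ENNReal.ofReal_add (by have := h0 y; positivity)
          (hf0 _ (abs_nonneg _))]
        exact ENNReal.ofReal_le_ofReal (hpt y)
    _ = ENNReal.ofReal s * (∫⁻ y, ENNReal.ofReal (h y ^ 4)) + ENNReal.ofReal (6 * κ * B) := by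
        rw [lintegral_add_left (by fun_prop), lintegral_const_mul _ (by fun_prop),
          lintegral_sub_left_eq_self (fun u : ℝ => ENNReal.ofReal (f |u|)) x, v4]
    _ ≤ ENNReal.ofReal s * ENNReal.ofReal (B ^ 2) + ENNReal.ofReal (6 * κ * B) := by gcongr
    _ = ENNReal.ofReal (7 * B * κ) := by
        rw [← ENNReal.ofReal_mul hs0.le, ← ENNReal.ofReal_add (by positivity) (by positivity)]
        congr 1
        rw [hs]
        field_simp
        ring

/-- The one-dimensional Hardy–Littlewood–Sobolev inequality for `|x - y| ^ (-1/2)`, with the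
`L^{4/3}` function written as a cube. -/
lemma lintegral_lintegral_pow_three_mul_rpow_le {h : ℝ → ℝ} (hm : Measurable h)
    (h0 : ∀ x, 0 ≤ h x) {B : ℝ} (hB : 0 < B)
    (hh : ∫⁻ x, ENNReal.ofReal (h x ^ 4) ≤ ENNReal.ofReal (B ^ 2)) :
    ∫⁻ x, ∫⁻ y, ENNReal.ofReal (h x ^ 3 * h y ^ 3 * |x - y| ^ (-(1 / 2) : ℝ)) ≤
      ENNReal.ofReal (14 * B ^ 3) := by
  set K : ℝ → ℝ → ℝ≥0∞ := fun x y =>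
    ENNReal.ofReal (h x ^ 3 * (min (h y) (h x) ^ 3 * |x - y| ^ (-(1 / 2) : ℝ))) with hK
  have hKm : Measurable (Function.uncurry K) := by
    simp only [hK, Function.uncurry_def]
    fun_prop
  have hpt : ∀ x y, ENNReal.ofReal (h x ^ 3 * h y ^ 3 * |x - y| ^ (-(1 / 2) : ℝ)) ≤
      K x y + K y x := by
    intro x y
    have hx := h0 x
    have hy := h0 y
    simp only [hK]
    rw [abs_sub_comm y x]
    rcases le_total (h x) (h y) with hc | hc
    · rw [min_eq_left hc]
      refine le_trans (le_of_eq ?_) le_add_self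
      congr 1
      ring
    · rw [min_eq_left hc]
      refine le_trans (le_of_eq ?_) le_self_add
      congr 1
      ring
  have hone : ∫⁻ x, ∫⁻ y, K x y ≤ ENNReal.ofReal (7 * B ^ 3) := by
    calc ∫⁻ x, ∫⁻ y, K x y ≤ ∫⁻ x, ENNReal.ofReal (7 * B) * ENNReal.ofReal (h x ^ 4) := by
          refine lintegral_mono fun x => ?_
          rcases (h0 x).eq_or_lt with hx | hx
          · simp [hK, ← hx]
          · simp only [hK]
            simp_rw [ENNReal.ofReal_mul (pow_nonneg (h0 x) 3)]
            rw [lintegral_const_mul _ (by fun_prop)]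
            calc _ ≤ ENNReal.ofReal (h x ^ 3) * ENNReal.ofReal (7 * B * h x) := by
                  gcongr
                  exact lintegral_min_pow_three_mul_rpow_le hm h0 hB hx hh x
              _ = _ := by
                  rw [← ENNReal.ofReal_mul (by positivity), ← ENNReal.ofReal_mul (by positivity)]
                  congr 1
                  ring
      _ = ENNReal.ofReal (7 * B) * ∫⁻ x, ENNReal.ofReal (h x ^ 4) :=
          lintegral_const_mul _ (by fun_prop)
      _ ≤ ENNReal.ofReal (7 * B) * ENNReal.ofReal (B ^ 2) := by gcongr
      _ = ENNReal.ofReal (7 * B ^ 3) := by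
          rw [← ENNReal.ofReal_mul (by positivity)]
          congr 1
          ring
  calc _ ≤ ∫⁻ x, ∫⁻ y, (K x y + K y x) := by
        exact lintegral_mono fun x => lintegral_mono fun y => hpt x y
    _ = ∫⁻ x, ((∫⁻ y, K x y) + ∫⁻ y, K y x) := by
        refine lintegral_congr fun x => ?_
        exact lintegral_add_left (hKm.comp (by fun_prop : Measurable fun y => (x, y))) _
    _ = (∫⁻ x, ∫⁻ y, K x y) + ∫⁻ x, ∫⁻ y, K y x :=
        lintegral_add_left hKm.lintegral_prod_right _
    _ = (∫⁻ x, ∫⁻ y, K x y) + ∫⁻ x, ∫⁻ y, K x y := by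
        congr 1
        exact lintegral_lintegral_swap (hKm.comp measurable_swap).aemeasurable
    _ ≤ ENNReal.ofReal (7 * B ^ 3) + ENNReal.ofReal (7 * B ^ 3) := add_le_add hone hone
    _ = ENNReal.ofReal (14 * B ^ 3) := by
        rw [← ENNReal.ofReal_add (by positivity) (by positivity)]
        congr 1
        ring

lemma continuous_phase (ν μ : ℝ) : Continuous (phase ν μ) := by
  unfold phase; fun_prop

lemma norm_exp_phase (ν μ ξ x t : ℝ) :
    ‖Complex.exp (Complex.I * (ξ * x + phase ν μ ξ * t))‖ = 1 := by
  rw [mul_comm, ← Complex.ofReal_mul, ← Complex.ofReal_mul, ← Complex.ofReal_add]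
  exact Complex.norm_exp_ofReal_mul_I _

/-- The adjoint of the linearized maximal operator, without the factor `|ξ| ^ (-1/4)`. -/
def phaseTransform (ν μ : ℝ) (τ : ℝ → ℝ) (g : ℝ → ℂ) (ξ : ℝ) : ℂ :=
  ∫ x : ℝ, Complex.exp (Complex.I * (ξ * x + phase ν μ ξ * τ x)) * g x

lemma integrableOn_band_rpow (ν μ N : ℝ) :
    IntegrableOn (fun ξ : ℝ => |ξ| ^ (-(1 / 2) : ℝ)) (band ν μ N) := by
  have ha := aconst_pos ν μ
  have hsub : band ν μ N ⊆ Set.Icc (-N) N := fun ξ hξ => abs_le.1 hξ.2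
  have hfin : volume (band ν μ N) ≠ ∞ :=
    ((measure_mono hsub).trans_lt (by simp)).ne
  refine Measure.integrableOn_of_bounded (M := aconst ν μ ^ (-(1 / 2) : ℝ)) hfin
    (by fun_prop : Measurable fun ξ : ℝ => |ξ| ^ (-(1 / 2) : ℝ)).aestronglyMeasurable ?_
  refine (ae_restrict_mem (measurableSet_band ν μ N)).mono fun ξ hξ => ?_
  rw [Real.norm_eq_abs, abs_of_nonneg (by positivity)]
  exact Real.rpow_le_rpow_of_nonpos ha hξ.1 (by norm_num)

/-- `T T*` identity: the weighted square norm of the transform of `g` with unimodular kernel `e`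
as a double integral. -/
lemma integral_mul_norm_sq_integral_eq {σ : Measure ℝ} [SFinite σ] {e : ℝ → ℝ → ℂ}
    (hem : Measurable (Function.uncurry e)) (hen : ∀ ξ x, ‖e ξ x‖ = 1) {w : ℝ → ℝ}
    (hwi : Integrable w σ) {g : ℝ → ℂ} (hg : Integrable g) :
    Integrable (fun ξ => w ξ * ‖∫ x, e ξ x * g x‖ ^ 2) σ ∧
    ((∫ ξ, w ξ * ‖∫ x, e ξ x * g x‖ ^ 2 ∂σ : ℝ) : ℂ) =
      ∫ z : ℝ × ℝ, ∫ ξ, (e ξ z.1 * (starRingEnd ℂ) (e ξ z.2)) *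
        ((w ξ : ℂ) * (g z.1 * (starRingEnd ℂ) (g z.2))) ∂σ ∂(volume.prod volume) := by
  set Ψ : ℝ × (ℝ × ℝ) → ℂ := fun z =>
    (e z.1 z.2.1 * (starRingEnd ℂ) (e z.1 z.2.2)) *
      ((w z.1 : ℂ) * (g z.2.1 * (starRingEnd ℂ) (g z.2.2))) with hΨ
  have hgg : Integrable (fun z : ℝ × ℝ => g z.1 * (starRingEnd ℂ) (g z.2))
      (volume.prod volume) := by
    have hc : Integrable (fun y => (starRingEnd ℂ) (g y)) :=
      (LinearIsometryEquiv.integrable_comp_iff Complex.conjLIE).2 hg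
    exact hg.mul_prod hc
  have hΨi : Integrable Ψ (σ.prod (volume.prod volume)) := by
    have h1 : Integrable (fun z : ℝ × (ℝ × ℝ) =>
        (w z.1 : ℂ) * (g z.2.1 * (starRingEnd ℂ) (g z.2.2))) (σ.prod (volume.prod volume)) :=
      Integrable.mul_prod (f := fun ξ => (w ξ : ℂ)) (Integrable.ofReal hwi) hgg
    have m1 : Measurable fun z : ℝ × (ℝ × ℝ) => e z.1 z.2.1 :=
      hem.comp (measurable_fst.prodMk (measurable_fst.comp measurable_snd))
    have m2 : Measurable fun z : ℝ × (ℝ × ℝ) => e z.1 z.2.2 :=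
      hem.comp (measurable_fst.prodMk (measurable_snd.comp measurable_snd))
    refine h1.bdd_mul (c := 1)
      (m1.mul (Complex.continuous_conj.measurable.comp m2)).aestronglyMeasurable
      (Filter.Eventually.of_forall fun z => ?_)
    rw [norm_mul, Complex.norm_conj, hen, hen, one_mul]
  have hin : ∀ ξ, ∫ z, Ψ (ξ, z) ∂(volume.prod volume) =
      ((w ξ * ‖∫ x, e ξ x * g x‖ ^ 2 : ℝ) : ℂ) := by
    intro ξ
    have h1 : ∀ z : ℝ × ℝ, Ψ (ξ, z) =
        (w ξ : ℂ) * ((e ξ z.1 * g z.1) * (starRingEnd ℂ) (e ξ z.2 * g z.2)) := fun z => by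
      simp only [hΨ, map_mul]; ring
    simp_rw [h1]
    rw [integral_const_mul, integral_prod_mul (fun x => e ξ x * g x)
      (fun y => (starRingEnd ℂ) (e ξ y * g y)), integral_conj, Complex.mul_conj,
      Complex.normSq_eq_norm_sq]
    push_cast
    ring
  constructor
  · have h1 := hΨi.integral_prod_left
    simp_rw [hin] at h1
    exact h1.re
  · rw [← integral_complex_ofReal]
    simp_rw [← hin]
    exact integral_integral_swap hΨi

lemma lintegral_band_phaseTransform_le {ν μ N : ℝ} (hμ : μ ≠ 0) {τ : ℝ → ℝ} (hτ : Measurable τ)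
    {g : ℝ → ℂ} (hg : Integrable g) {k : ℝ → ℝ} (hk : Measurable k) (hk0 : ∀ x, 0 ≤ k x)
    (hgk : ∀ x, ‖g x‖ = k x ^ 3) {B : ℝ} (hB : 0 < B)
    (hkB : ∫⁻ x, ENNReal.ofReal (k x ^ 4) ≤ ENNReal.ofReal (B ^ 2)) :
    ∫⁻ ξ in band ν μ N, ENNReal.ofReal (|ξ| ^ (-(1 / 2) : ℝ) * ‖phaseTransform ν μ τ g ξ‖ ^ 2) ≤
      ENNReal.ofReal (1456 * B ^ 3) := by
  set e : ℝ → ℝ → ℂ := fun ξ x => Complex.exp (Complex.I * (ξ * x + phase ν μ ξ * τ x)) with he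
  have hph := (continuous_phase ν μ).measurable
  have hem : Measurable (Function.uncurry e) := by
    simp only [he, Function.uncurry_def]
    fun_prop
  have hen : ∀ ξ x, ‖e ξ x‖ = 1 := fun ξ x => norm_exp_phase ν μ ξ x (τ x)
  set w : ℝ → ℝ := fun ξ => |ξ| ^ (-(1 / 2) : ℝ) with hw
  have hw0 : ∀ ξ, 0 ≤ w ξ := fun ξ => by positivity
  have hwi : IntegrableOn w (band ν μ N) := integrableOn_band_rpow ν μ N
  obtain ⟨hGi, hswap⟩ := integral_mul_norm_sq_integral_eq hem hen hwi hg
  set G := phaseTransform ν μ τ g with hG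
  set Ψ : ℝ × (ℝ × ℝ) → ℂ := fun z =>
    (e z.1 z.2.1 * (starRingEnd ℂ) (e z.1 z.2.2)) *
      ((w z.1 : ℂ) * (g z.2.1 * (starRingEnd ℂ) (g z.2.2))) with hΨ
  change Integrable (fun ξ => w ξ * ‖G ξ‖ ^ 2) (volume.restrict (band ν μ N)) at hGi
  change ((∫ ξ in band ν μ N, w ξ * ‖G ξ‖ ^ 2 : ℝ) : ℂ) =
      ∫ z : ℝ × ℝ, (∫ ξ in band ν μ N, Ψ (ξ, z)) ∂(volume.prod volume) at hswap
  rw [← ofReal_integral_eq_lintegral_ofReal hGi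
    (Filter.Eventually.of_forall fun ξ => mul_nonneg (hw0 ξ) (sq_nonneg _))]
  have hker : ∀ x y : ℝ, x ≠ y → ‖∫ ξ in band ν μ N, Ψ (ξ, (x, y))‖ₑ ≤
      ENNReal.ofReal 104 * ENNReal.ofReal (k x ^ 3 * k y ^ 3 * |x - y| ^ (-(1 / 2) : ℝ)) := by
    intro x y hxy
    have h1 : ∀ ξ, Ψ (ξ, (x, y)) = (g x * (starRingEnd ℂ) (g y)) *
        (Complex.exp (Complex.I * (ξ * (x - y : ℝ) + phase ν μ ξ * (τ x - τ y : ℝ))) *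
          ((|ξ| ^ (-(1 / 2) : ℝ) : ℝ) : ℂ)) := by
      intro ξ
      have : e ξ x * (starRingEnd ℂ) (e ξ y) =
          Complex.exp (Complex.I * (ξ * (x - y : ℝ) + phase ν μ ξ * (τ x - τ y : ℝ))) := by
        simp only [he, ← Complex.exp_conj, ← Complex.exp_add]
        congr 1
        simp only [map_mul, map_add, Complex.conj_I, Complex.conj_ofReal]
        push_cast
        ring
      simp only [hΨ]
      rw [this]
      simp only [hw]
      ring
    simp_rw [h1]
    rw [integral_const_mul, ← ofReal_norm, ← ENNReal.ofReal_mul (by norm_num)]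
    apply ENNReal.ofReal_le_ofReal
    rw [norm_mul, norm_mul, Complex.norm_conj, hgk, hgk]
    have h2 := norm_integral_band_le (ν := ν) hμ (sub_ne_zero.2 hxy) N (τ x - τ y)
    have hx := hk0 x
    have hy := hk0 y
    calc _ ≤ k x ^ 3 * k y ^ 3 * (104 * |x - y| ^ (-(1 / 2) : ℝ)) := by gcongr
      _ = _ := by ring
  calc ENNReal.ofReal (∫ ξ in band ν μ N, w ξ * ‖G ξ‖ ^ 2)
      ≤ ‖((∫ ξ in band ν μ N, w ξ * ‖G ξ‖ ^ 2 : ℝ) : ℂ)‖ₑ := by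
        rw [← ofReal_norm, Complex.norm_real]
        exact ENNReal.ofReal_le_ofReal (le_abs_self _)
    _ ≤ ∫⁻ z : ℝ × ℝ, ‖∫ ξ in band ν μ N, Ψ (ξ, z)‖ₑ ∂(volume.prod volume) := by
        rw [hswap]
        exact enorm_integral_le_lintegral_enorm _
    _ ≤ ∫⁻ x, ∫⁻ y, ‖∫ ξ in band ν μ N, Ψ (ξ, (x, y))‖ₑ := lintegral_prod_le _
    _ ≤ ∫⁻ x, ∫⁻ y, ENNReal.ofReal 104 *
          ENNReal.ofReal (k x ^ 3 * k y ^ 3 * |x - y| ^ (-(1 / 2) : ℝ)) := by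
        refine lintegral_mono fun x => lintegral_mono_ae ?_
        have : ∀ᵐ y : ℝ, y ≠ x := by simp [ae_iff]
        exact this.mono fun y hy => hker x y (Ne.symm hy)
    _ = ENNReal.ofReal 104 *
          ∫⁻ x, ∫⁻ y, ENNReal.ofReal (k x ^ 3 * k y ^ 3 * |x - y| ^ (-(1 / 2) : ℝ)) := by
        rw [← lintegral_const_mul' _ _ ENNReal.ofReal_ne_top]
        exact lintegral_congr fun x => lintegral_const_mul' _ _ ENNReal.ofReal_ne_top
    _ ≤ ENNReal.ofReal 104 * ENNReal.ofReal (14 * B ^ 3) := by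
        gcongr
        exact lintegral_lintegral_pow_three_mul_rpow_le hk hk0 hB hkB
    _ = ENNReal.ofReal (1456 * B ^ 3) := by
        rw [← ENNReal.ofReal_mul (by norm_num)]
        congr 1
        ring

/-- The high frequency region `a ≤ |ξ|`. -/
def highFreq (ν μ : ℝ) : Set ℝ := {ξ | aconst ν μ ≤ |ξ|}

lemma measurableSet_highFreq (ν μ : ℝ) : MeasurableSet (highFreq ν μ) :=
  measurableSet_le measurable_const measurable_norm

lemma lintegral_highFreq_phaseTransform_le {ν μ : ℝ} (hμ : μ ≠ 0) {τ : ℝ → ℝ}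
    (hτ : Measurable τ) {g : ℝ → ℂ} (hg : Integrable g) {k : ℝ → ℝ} (hk : Measurable k)
    (hk0 : ∀ x, 0 ≤ k x) (hgk : ∀ x, ‖g x‖ = k x ^ 3) {B : ℝ} (hB : 0 < B)
    (hkB : ∫⁻ x, ENNReal.ofReal (k x ^ 4) ≤ ENNReal.ofReal (B ^ 2)) :
    ∫⁻ ξ in highFreq ν μ,
        ENNReal.ofReal (|ξ| ^ (-(1 / 2) : ℝ) * ‖phaseTransform ν μ τ g ξ‖ ^ 2) ≤
      ENNReal.ofReal (1456 * B ^ 3) := by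
  have hun : highFreq ν μ = ⋃ n : ℕ, band ν μ n := by
    ext ξ
    simp only [highFreq, band, Set.mem_iUnion, Set.mem_ofPred_eq, exists_and_left]
    exact ⟨fun h => ⟨h, exists_nat_ge _⟩, fun h => h.1⟩
  have hmono : Monotone fun n : ℕ => band ν μ n := fun m n hmn ξ hξ =>
    ⟨hξ.1, hξ.2.trans (by exact_mod_cast hmn)⟩
  rw [hun, setLIntegral_iUnion_of_directed _ hmono.directed_le]
  exact iSup_le fun n => lintegral_band_phaseTransform_le hμ hτ hg hk hk0 hgk hB hkB

/-- The function `2π D_x^{-1/4} S(t) P^a u₀` in terms of `v = FT u₀`. -/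
def highFreqSol (ν μ : ℝ) (v : ℝ → ℂ) (x t : ℝ) : ℂ :=
  ∫ ξ in highFreq ν μ, ((|ξ| ^ (-(1 / 4) : ℝ) : ℝ) : ℂ) *
    Complex.exp (Complex.I * (ξ * x + phase ν μ ξ * t)) * v ξ

lemma rpow_le_one_of_mem_highFreq {ν μ ξ : ℝ} (hξ : ξ ∈ highFreq ν μ) :
    |ξ| ^ (-(1 / 4) : ℝ) ≤ 1 := by
  apply Real.rpow_le_one_of_one_le_of_nonpos _ (by norm_num)
  have h : aconst ν μ ≤ |ξ| := hξ
  unfold aconst at h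
  have := le_max_left (1 : ℝ) |2 * ν / (3 * μ)|
  linarith

lemma norm_highFreqSol_integrand_le {ν μ ξ : ℝ} (hξ : ξ ∈ highFreq ν μ) (v : ℝ → ℂ) (x t : ℝ) :
    ‖((|ξ| ^ (-(1 / 4) : ℝ) : ℝ) : ℂ) *
      Complex.exp (Complex.I * (ξ * x + phase ν μ ξ * t)) * v ξ‖ ≤ ‖v ξ‖ := by
  rw [norm_mul, norm_mul, norm_exp_phase, mul_one, Complex.norm_real, Real.norm_eq_abs,
    abs_of_nonneg (by positivity)]
  exact mul_le_of_le_one_left (norm_nonneg _) (rpow_le_one_of_mem_highFreq hξ)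

lemma continuous_highFreqSol (ν μ : ℝ) {v : ℝ → ℂ} (hv : Integrable v) :
    Continuous (Function.uncurry (highFreqSol ν μ v)) := by
  change Continuous fun z : ℝ × ℝ => ∫ ξ in highFreq ν μ, ((|ξ| ^ (-(1 / 4) : ℝ) : ℝ) : ℂ) *
    Complex.exp (Complex.I * (ξ * z.1 + phase ν μ ξ * z.2)) * v ξ
  have hph := (continuous_phase ν μ).measurable
  refine continuous_of_dominated (bound := fun ξ => ‖v ξ‖) (fun z => ?_) (fun z => ?_)
    hv.norm.integrableOn (Filter.Eventually.of_forall fun ξ => by fun_prop)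
  · have hm : Measurable fun ξ : ℝ => ((|ξ| ^ (-(1 / 4) : ℝ) : ℝ) : ℂ) *
        Complex.exp (Complex.I * (ξ * z.1 + phase ν μ ξ * z.2)) := by fun_prop
    exact hm.aestronglyMeasurable.mul hv.aestronglyMeasurable.restrict
  · exact (ae_restrict_mem (measurableSet_highFreq ν μ)).mono fun ξ hξ =>
      norm_highFreqSol_integrand_le hξ v z.1 z.2

lemma norm_highFreqSol_le (ν μ : ℝ) {v : ℝ → ℂ} (hv : Integrable v) (x t : ℝ) :
    ‖highFreqSol ν μ v x t‖ ≤ ∫ ξ, ‖v ξ‖ := by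
  unfold highFreqSol
  refine (norm_integral_le_of_norm_le hv.norm.integrableOn
    ((ae_restrict_mem (measurableSet_highFreq ν μ)).mono fun ξ hξ =>
      norm_highFreqSol_integrand_le hξ v x t)).trans ?_
  exact setIntegral_le_integral hv.norm (Filter.Eventually.of_forall fun ξ => norm_nonneg _)

lemma integral_highFreqSol_mul {ν μ : ℝ} {v : ℝ → ℂ} (hv : Integrable v) {τ : ℝ → ℝ}
    (hτ : Measurable τ) {g : ℝ → ℂ} (hg : Integrable g) :
    ∫ x, highFreqSol ν μ v x (τ x) * g x = ∫ ξ in highFreq ν μ,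
      ((|ξ| ^ (-(1 / 4) : ℝ) : ℝ) : ℂ) * v ξ * phaseTransform ν μ τ g ξ := by
  have hph := (continuous_phase ν μ).measurable
  have hmv : Integrable (fun ξ => ((|ξ| ^ (-(1 / 4) : ℝ) : ℝ) : ℂ) * v ξ)
      (volume.restrict (highFreq ν μ)) := by
    have hm : Measurable fun ξ : ℝ => ((|ξ| ^ (-(1 / 4) : ℝ) : ℝ) : ℂ) := by fun_prop
    refine hv.integrableOn.bdd_mul (c := 1) hm.aestronglyMeasurable
      ((ae_restrict_mem (measurableSet_highFreq ν μ)).mono fun ξ hξ => ?_)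
    rw [Complex.norm_real, Real.norm_eq_abs, abs_of_nonneg (by positivity)]
    exact rpow_le_one_of_mem_highFreq hξ
  have hΨ : Integrable (fun z : ℝ × ℝ =>
      Complex.exp (Complex.I * (z.2 * z.1 + phase ν μ z.2 * τ z.1)) *
        (g z.1 * (((|z.2| ^ (-(1 / 4) : ℝ) : ℝ) : ℂ) * v z.2)))
      (volume.prod (volume.restrict (highFreq ν μ))) := by
    have hm : Measurable fun z : ℝ × ℝ =>
        Complex.exp (Complex.I * (z.2 * z.1 + phase ν μ z.2 * τ z.1)) := by fun_prop
    refine (hg.mul_prod hmv).bdd_mul (c := 1) hm.aestronglyMeasurable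
      (Filter.Eventually.of_forall fun z => ?_)
    rw [norm_exp_phase]
  have hswap := integral_integral_swap (f := fun x ξ : ℝ =>
    Complex.exp (Complex.I * (ξ * x + phase ν μ ξ * τ x)) *
      (g x * (((|ξ| ^ (-(1 / 4) : ℝ) : ℝ) : ℂ) * v ξ))) hΨ
  refine Eq.trans (integral_congr_ae (Filter.Eventually.of_forall fun x => ?_))
    (hswap.trans (integral_congr_ae (Filter.Eventually.of_forall fun ξ => ?_)))
  · simp only [highFreqSol]
    rw [← integral_mul_const]
    congr 1
    ext ξ
    ring
  · simp only [phaseTransform]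
    rw [← integral_const_mul]
    congr 1
    ext x
    ring

lemma measurable_phaseTransform {ν μ : ℝ} {τ : ℝ → ℝ} (hτ : Measurable τ) {g : ℝ → ℂ}
    (hg : Measurable g) : Measurable (phaseTransform ν μ τ g) := by
  have hph := (continuous_phase ν μ).measurable
  have hm : Measurable (fun z : ℝ × ℝ =>
    Complex.exp (Complex.I * (z.1 * z.2 + phase ν μ z.1 * τ z.2)) * g z.2) := by fun_prop
  exact hm.stronglyMeasurable.integral_prod_right'.measurable

lemma measurable_along {F : ℝ → ℝ → ℂ} (hF : Continuous (Function.uncurry F)) {τ : ℝ → ℝ}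
    (hτ : Measurable τ) : Measurable fun x => F x (τ x) :=
  hF.measurable.comp (measurable_id.prodMk hτ)

/-- The maximal estimate linearized along a measurable choice of times. -/
lemma lintegral_highFreqSol_pow_four_le {ν μ : ℝ} (hμ : μ ≠ 0) {v : ℝ → ℂ} (hv : Integrable v)
    {W : ℝ} (hW : ∫⁻ ξ, ‖v ξ‖ₑ ^ 2 ≤ ENNReal.ofReal W) {τ : ℝ → ℝ}
    (hτ : Measurable τ) (R : ℝ) :
    ∫⁻ x in Set.Icc (-R) R, ‖highFreqSol ν μ v x (τ x)‖ₑ ^ 4 ≤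
      ENNReal.ofReal ((1456 * W) ^ 2) := by
  set f : ℝ → ℂ := fun x => highFreqSol ν μ v x (τ x) with hf
  have hfm : Measurable f := measurable_along (continuous_highFreqSol ν μ hv) hτ
  set S : Set ℝ := Set.Icc (-R) R with hS
  have hSm : MeasurableSet S := measurableSet_Icc
  have hSf : volume S ≠ ∞ := by simp [hS]
  set M : ℝ := ∫ ξ, ‖v ξ‖ with hM
  have hfM : ∀ x, ‖f x‖ ≤ M := fun x => norm_highFreqSol_le ν μ hv x (τ x)
  set k : ℝ → ℝ := S.indicator fun x => ‖f x‖ with hk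
  have hk0 : ∀ x, 0 ≤ k x := fun x => Set.indicator_nonneg (fun _ _ => norm_nonneg _) x
  have hkm : Measurable k := hfm.norm.indicator hSm
  set g : ℝ → ℂ := S.indicator fun x => (starRingEnd ℂ) (f x) * (‖f x‖ ^ 2 : ℝ) with hg
  have hgm' : Measurable fun x => (starRingEnd ℂ) (f x) * ((‖f x‖ ^ 2 : ℝ) : ℂ) :=
    (Complex.continuous_conj.measurable.comp hfm).mul (by fun_prop)
  have hgm : Measurable g := hgm'.indicator hSm
  have hgi : Integrable g := by
    rw [hg, integrable_indicator_iff hSm]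
    refine Measure.integrableOn_of_bounded (M := M * M ^ 2) hSf hgm'.aestronglyMeasurable
      (Filter.Eventually.of_forall fun x => ?_)
    rw [norm_mul, Complex.norm_conj, Complex.norm_real, Real.norm_eq_abs,
      abs_of_nonneg (sq_nonneg _)]
    have := hfM x
    have h0 := (norm_nonneg _).trans this
    gcongr
  have hgk : ∀ x, ‖g x‖ = k x ^ 3 := by
    intro x
    by_cases hx : x ∈ S
    · simp only [hg, hk, Set.indicator_of_mem hx]
      rw [norm_mul, Complex.norm_conj, Complex.norm_real, Real.norm_eq_abs,
        abs_of_nonneg (sq_nonneg _)]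
      ring
    · simp [hg, hk, Set.indicator_of_notMem hx]
  have hk4 : ∀ x, k x ^ 4 = S.indicator (fun x => ‖f x‖ ^ 4) x := by
    intro x
    by_cases hx : x ∈ S <;> simp [hk, hx]
  have hki : Integrable fun x => k x ^ 4 := by
    simp_rw [hk4]
    rw [integrable_indicator_iff hSm]
    refine Measure.integrableOn_of_bounded (M := M ^ 4) hSf
      (hfm.norm.pow_const 4).aestronglyMeasurable (Filter.Eventually.of_forall fun x => ?_)
    rw [Real.norm_eq_abs, abs_of_nonneg (by positivity)]
    have := hfM x
    gcongr
  set B : ℝ := √(∫ x, k x ^ 4) with hB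
  have hint0 : 0 ≤ ∫ x, k x ^ 4 := integral_nonneg fun x => by have := hk0 x; positivity
  have hB2 : B ^ 2 = ∫ x, k x ^ 4 := Real.sq_sqrt hint0
  have hkB : ∫⁻ x, ENNReal.ofReal (k x ^ 4) = ENNReal.ofReal (B ^ 2) := by
    rw [hB2, ofReal_integral_eq_lintegral_ofReal hki]
    exact Filter.Eventually.of_forall fun x => by have := hk0 x; positivity
  have hLHS : ∫⁻ x in S, ‖f x‖ₑ ^ 4 = ENNReal.ofReal (B ^ 2) := by
    rw [← hkB, ← lintegral_indicator hSm]
    refine lintegral_congr fun x => ?_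
    by_cases hx : x ∈ S
    · rw [hk4, Set.indicator_of_mem hx, Set.indicator_of_mem hx,
        ENNReal.ofReal_pow (norm_nonneg _), ofReal_norm]
    · rw [hk4, Set.indicator_of_notMem hx, Set.indicator_of_notMem hx, ENNReal.ofReal_zero]
  rw [hLHS]
  apply ENNReal.ofReal_le_ofReal
  rcases (Real.sqrt_nonneg (∫ x, k x ^ 4)).eq_or_lt with hB0 | hB0
  · rw [hB, ← hB0, zero_pow two_ne_zero]; positivity
  rw [← hB] at hB0
  have hdual : ((B ^ 2 : ℝ) : ℂ) = ∫ ξ in highFreq ν μ,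
      ((|ξ| ^ (-(1 / 4) : ℝ) : ℝ) : ℂ) * v ξ * phaseTransform ν μ τ g ξ := by
    rw [← integral_highFreqSol_mul hv hτ hgi, hB2, ← integral_complex_ofReal]
    refine integral_congr_ae (Filter.Eventually.of_forall fun x => ?_)
    change ((k x ^ 4 : ℝ) : ℂ) = f x * g x
    rw [hk4]
    by_cases hx : x ∈ S
    · simp only [hg, Set.indicator_of_mem hx]
      rw [← mul_assoc, Complex.mul_conj, Complex.normSq_eq_norm_sq, ← Complex.ofReal_mul]
      congr 1
      ring
    · simp [hg, Set.indicator_of_notMem hx]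
  have hGm : Measurable (phaseTransform ν μ τ g) := measurable_phaseTransform hτ hgm
  have hG := lintegral_highFreq_phaseTransform_le (ν := ν) hμ hτ hgi hkm hk0 hgk hB0 hkB.le
  have hCS : ENNReal.ofReal (B ^ 2) ≤
      ENNReal.ofReal (1456 * B ^ 3) ^ (1 / 2 : ℝ) * ENNReal.ofReal W ^ (1 / 2 : ℝ) := by
    calc ENNReal.ofReal (B ^ 2) = ‖((B ^ 2 : ℝ) : ℂ)‖ₑ := by
          rw [← ofReal_norm, Complex.norm_real, Real.norm_eq_abs, abs_of_nonneg (sq_nonneg _)]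
      _ ≤ ∫⁻ ξ in highFreq ν μ, ‖((|ξ| ^ (-(1 / 4) : ℝ) : ℝ) : ℂ) * v ξ *
            phaseTransform ν μ τ g ξ‖ₑ := by
          rw [hdual]; exact enorm_integral_le_lintegral_enorm _
      _ = ∫⁻ ξ in highFreq ν μ, ((fun ξ : ℝ => ENNReal.ofReal (|ξ| ^ (-(1 / 4) : ℝ) *
            ‖phaseTransform ν μ τ g ξ‖)) * fun ξ => ‖v ξ‖ₑ) ξ := by
          refine lintegral_congr fun ξ => ?_
          rw [Pi.mul_apply, ← ofReal_norm, ← ofReal_norm, ← ENNReal.ofReal_mul (by positivity)]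
          congr 1
          rw [norm_mul, norm_mul, Complex.norm_real, Real.norm_eq_abs,
            abs_of_nonneg (by positivity)]
          ring
      _ ≤ (∫⁻ ξ in highFreq ν μ, ENNReal.ofReal (|ξ| ^ (-(1 / 4) : ℝ) *
            ‖phaseTransform ν μ τ g ξ‖) ^ (2 : ℝ)) ^ (1 / 2 : ℝ) *
          (∫⁻ ξ in highFreq ν μ, ‖v ξ‖ₑ ^ (2 : ℝ)) ^ (1 / 2 : ℝ) := by
          refine ENNReal.lintegral_mul_le_Lp_mul_Lq _ Real.HolderConjugate.two_two ?_ ?_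
          · exact Measurable.aemeasurable (by fun_prop)
          · exact hv.aestronglyMeasurable.restrict.enorm
      _ ≤ _ := by
          gcongr
          · refine le_trans (le_of_eq (lintegral_congr fun ξ => ?_)) hG
            rw [ENNReal.rpow_two, ← ENNReal.ofReal_pow (by positivity), mul_pow]
            congr 2
            rw [← Real.rpow_natCast, ← Real.rpow_mul (abs_nonneg _)]
            norm_num
          · simp_rw [ENNReal.rpow_two]
            exact (setLIntegral_le_lintegral _ _).trans hW
  have hsq : ENNReal.ofReal ((B ^ 2) ^ 2) ≤ ENNReal.ofReal (1456 * B ^ 3 * W) := by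
    have h2 := pow_le_pow_left' hCS 2
    have key : ∀ z : ℝ≥0∞, (z ^ (1 / 2 : ℝ)) ^ 2 = z := fun z => by
      rw [← ENNReal.rpow_natCast, ← ENNReal.rpow_mul]
      norm_num
    rwa [mul_pow, key, key, ← ENNReal.ofReal_pow (by positivity),
      ← ENNReal.ofReal_mul (by positivity)] at h2
  have hW0 : B ≤ 1456 * W := by
    have h4 : 0 < (B ^ 2) ^ 2 := by positivity
    rcases le_or_gt (1456 * B ^ 3 * W) 0 with h | h
    · rw [ENNReal.ofReal_of_nonpos h, nonpos_iff_eq_zero, ENNReal.ofReal_eq_zero] at hsq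
      linarith
    · rw [ENNReal.ofReal_le_ofReal_iff h.le] at hsq
      have h3 : 0 < B ^ 3 := by positivity
      have : B ^ 3 * B ≤ B ^ 3 * (1456 * W) := by nlinarith
      exact le_of_mul_le_mul_left this h3
  gcongr


/-- The first `n + 1` times of a dense sequence, chosen so as to maximize `‖F x t‖`. -/
def greedyTime (F : ℝ → ℝ → ℂ) : ℕ → ℝ → ℝ
  | 0, _ => TopologicalSpace.denseSeq ℝ 0
  | n + 1, x =>
    if ‖F x (greedyTime F n x)‖ < ‖F x (TopologicalSpace.denseSeq ℝ (n + 1))‖ then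
      TopologicalSpace.denseSeq ℝ (n + 1)
    else greedyTime F n x

lemma measurable_greedyTime {F : ℝ → ℝ → ℂ} (hF : Continuous (Function.uncurry F)) (n : ℕ) :
    Measurable (greedyTime F n) := by
  induction n with
  | zero => exact measurable_const
  | succ n ih =>
    have h1 : Measurable fun x => F x (greedyTime F n x) := measurable_along hF ih
    have h2 : Measurable fun x => F x (TopologicalSpace.denseSeq ℝ (n + 1)) :=
      measurable_along hF measurable_const
    exact Measurable.ite (measurableSet_lt h1.norm h2.norm) measurable_const ih

lemma norm_greedyTime_succ (F : ℝ → ℝ → ℂ) (n : ℕ) (x : ℝ) :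
    ‖F x (greedyTime F (n + 1) x)‖ =
      max ‖F x (greedyTime F n x)‖ ‖F x (TopologicalSpace.denseSeq ℝ (n + 1))‖ := by
  rw [greedyTime]
  split_ifs with h
  · exact (max_eq_right h.le).symm
  · exact (max_eq_left (not_lt.1 h)).symm

lemma monotone_norm_greedyTime (F : ℝ → ℝ → ℂ) (x : ℝ) :
    Monotone fun n => ‖F x (greedyTime F n x)‖ :=
  monotone_nat_of_le_succ fun n => (norm_greedyTime_succ F n x).symm ▸ le_max_left _ _

lemma norm_denseSeq_le_greedyTime (F : ℝ → ℝ → ℂ) (n : ℕ) (x : ℝ) :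
    ‖F x (TopologicalSpace.denseSeq ℝ n)‖ ≤ ‖F x (greedyTime F n x)‖ := by
  cases n with
  | zero => exact le_rfl
  | succ n => exact (norm_greedyTime_succ F n x).symm ▸ le_max_right _ _

lemma enorm_le_iSup_greedyTime {F : ℝ → ℝ → ℂ} (hF : Continuous (Function.uncurry F))
    (x t : ℝ) : ‖F x t‖ₑ ≤ ⨆ n, ‖F x (greedyTime F n x)‖ₑ := by
  have hc : Continuous fun t => ‖F x t‖ₑ :=
    (hF.comp (continuous_const.prodMk continuous_id)).enorm
  have hcl : IsClosed {t | ‖F x t‖ₑ ≤ ⨆ n, ‖F x (greedyTime F n x)‖ₑ} :=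
    isClosed_le hc continuous_const
  refine (hcl.closure_subset_iff.2 ?_) ((TopologicalSpace.denseRange_denseSeq ℝ) t)
  rintro _ ⟨n, rfl⟩
  refine le_iSup_of_le (f := fun n => ‖F x (greedyTime F n x)‖ₑ) n ?_
  exact enorm_le_iff_norm_le.2 (norm_denseSeq_le_greedyTime F n x)

/-- Bounds along all measurable choices of times control the maximal function. -/
lemma lintegral_eLpNorm_top_pow_four_le {F : ℝ → ℝ → ℂ} (hF : Continuous (Function.uncurry F))
    {K : ℝ≥0∞} (h : ∀ τ : ℝ → ℝ, Measurable τ → ∀ R : ℝ,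
      ∫⁻ x in Set.Icc (-R) R, ‖F x (τ x)‖ₑ ^ 4 ≤ K) :
    ∫⁻ x, eLpNorm (F x) ∞ volume ^ 4 ≤ K := by
  set H : ℕ → ℝ → ℝ≥0∞ := fun n =>
    (Set.Icc (-(n : ℝ)) n).indicator fun x => ‖F x (greedyTime F n x)‖ₑ ^ 4 with hH
  have hmono : ∀ x, Monotone fun n => ‖F x (greedyTime F n x)‖ₑ := fun x m n hmn =>
    enorm_le_iff_norm_le.2 (monotone_norm_greedyTime F x hmn)
  have hHmono : Monotone H := by
    intro m n hmn x
    simp only [hH]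
    have hmn' : (m : ℝ) ≤ n := by exact_mod_cast hmn
    by_cases hx : x ∈ Set.Icc (-(m : ℝ)) m
    · have hx' : x ∈ Set.Icc (-(n : ℝ)) n := ⟨by linarith [hx.1], by linarith [hx.2]⟩
      rw [Set.indicator_of_mem hx, Set.indicator_of_mem hx']
      exact pow_le_pow_left' (hmono x hmn) 4
    · rw [Set.indicator_of_notMem hx]
      exact zero_le
  have hHm : ∀ n, Measurable (H n) := fun n =>
    ((measurable_along hF (measurable_greedyTime hF n)).enorm.pow_const 4).indicator
      measurableSet_Icc
  have hle : ∀ x, eLpNorm (F x) ∞ volume ^ 4 ≤ ⨆ n, H n x := by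
    intro x
    have h1 : eLpNorm (F x) ∞ volume ≤ ⨆ n, ‖F x (greedyTime F n x)‖ₑ := by
      rw [eLpNorm_exponent_top]
      exact eLpNormEssSup_le_of_ae_enorm_bound
        (Filter.Eventually.of_forall fun t => enorm_le_iSup_greedyTime hF x t)
    refine (pow_le_pow_left' h1 4).trans ?_
    rw [ENNReal.iSup_pow]
    refine iSup_le fun n => ?_
    obtain ⟨m, hm⟩ := exists_nat_ge |x|
    have hx : x ∈ Set.Icc (-((max m n : ℕ) : ℝ)) (max m n : ℕ) := by
      have hmm : (m : ℝ) ≤ (max m n : ℕ) := by exact_mod_cast le_max_left m n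
      exact abs_le.1 (hm.trans hmm)
    refine le_iSup_of_le (max m n) ?_
    simp only [hH]
    rw [Set.indicator_of_mem hx]
    exact pow_le_pow_left' (hmono x (le_max_right m n)) 4
  calc ∫⁻ x, eLpNorm (F x) ∞ volume ^ 4 ≤ ∫⁻ x, ⨆ n, H n x := lintegral_mono hle
    _ = ⨆ n, ∫⁻ x, H n x := lintegral_iSup hHm hHmono
    _ ≤ K := iSup_le fun n => by
        simp only [hH]
        rw [lintegral_indicator measurableSet_Icc]
        exact h _ (measurable_greedyTime hF n) n

open scoped FourierTransform in
lemma FT_eq_fourier (u : SchwartzMap ℝ ℂ) (ξ : ℝ) :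
    FT (fun x => u x) ξ = (𝓕 u) (ξ / (2 * π)) := by
  rw [SchwartzMap.fourier_coe, Real.fourier_real_eq_integral_exp_smul, FT]
  refine integral_congr_ae (Filter.Eventually.of_forall fun x => ?_)
  simp only [smul_eq_mul]
  congr 2
  have : (π : ℂ) ≠ 0 := by exact_mod_cast Real.pi_ne_zero
  push_cast
  field_simp

open scoped FourierTransform in
lemma integrable_FT (u : SchwartzMap ℝ ℂ) : Integrable (FT fun x => u x) := by
  rw [funext (FT_eq_fourier u)]
  exact (𝓕 u).integrable.comp_div (by positivity)

open scoped FourierTransform in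
lemma lintegral_enorm_FT_sq (u : SchwartzMap ℝ ℂ) :
    ∫⁻ ξ, ‖FT (fun x => u x) ξ‖ₑ ^ 2 = ENNReal.ofReal (2 * π * ∫ x, ‖u x‖ ^ 2) := by
  have hi : Integrable fun ξ => ‖(𝓕 u) ξ‖ ^ 2 := ((𝓕 u).memLp 2).integrable_norm_pow (by norm_num)
  have hi2 : Integrable fun ξ => ‖(𝓕 u) (ξ / (2 * π))‖ ^ 2 := hi.comp_div (by positivity)
  have h1 : ∫ ξ, ‖(𝓕 u) (ξ / (2 * π))‖ ^ 2 = 2 * π * ∫ x, ‖u x‖ ^ 2 := by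
    rw [Measure.integral_comp_div (fun ξ => ‖(𝓕 u : SchwartzMap ℝ ℂ) ξ‖ ^ 2) (2 * π), SchwartzMap.integral_norm_sq_fourier,
      abs_of_pos (by positivity), smul_eq_mul]
  rw [← h1, ofReal_integral_eq_lintegral_ofReal hi2
    (Filter.Eventually.of_forall fun ξ => by positivity)]
  refine lintegral_congr fun ξ => ?_
  rw [FT_eq_fourier, ENNReal.ofReal_pow (norm_nonneg _), ofReal_norm]

lemma eLpNorm_two_sq (u : SchwartzMap ℝ ℂ) :
    eLpNorm (fun x => u x) 2 volume = ENNReal.ofReal (√(∫ x, ‖u x‖ ^ 2)) := by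
  have hi : Integrable fun x => ‖u x‖ ^ 2 := (u.memLp 2).integrable_norm_pow (by norm_num)
  rw [eLpNorm_eq_lintegral_rpow_enorm_toReal (by norm_num) (by norm_num), Real.sqrt_eq_rpow,
    ← ENNReal.ofReal_rpow_of_nonneg (integral_nonneg fun x => by positivity) (by norm_num),
    ofReal_integral_eq_lintegral_ofReal hi (Filter.Eventually.of_forall fun x => by positivity)]
  simp only [ENNReal.toReal_ofNat, ENNReal.rpow_two]
  congr 1
  simp_rw [ENNReal.ofReal_pow (norm_nonneg _), ofReal_norm]

lemma DSgrpPa_eq (ν μ : ℝ) (u : ℝ → ℂ) (x t : ℝ) :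
    DSgrpPa ν μ (-(1 / 4)) u x t = (2 * π)⁻¹ • highFreqSol ν μ (FT u) x t := by
  unfold DSgrpPa highFreqSol
  rw [← integral_indicator (measurableSet_highFreq ν μ)]
  congr 2

lemma norm_DSgrpPa_le (ν μ : ℝ) (u : ℝ → ℂ) (x t : ℝ) :
    ‖DSgrpPa ν μ (-(1 / 4)) u x t‖ ≤ ‖highFreqSol ν μ (FT u) x t‖ := by
  rw [DSgrpPa_eq, norm_smul, Real.norm_eq_abs, abs_of_pos (by positivity)]
  refine mul_le_of_le_one_left (norm_nonneg _) (inv_le_one_of_one_le₀ ?_)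
  linarith [Real.pi_gt_three]

/-- **Lemma 2.1, estimate (2.3)** (maximal function estimate for the Benjamin group):
there is `C > 0`, depending only on `ν` and `μ`, such that for every Schwartz
datum `u₀` one has `‖D_x^{-1/4} S(t) P^a u₀‖_{L⁴_x L^∞_t} ≤ C ‖u₀‖_{L²}`. -/
theorem benjamin_maximal_estimate (ν μ : ℝ) (hμ : μ ≠ 0) :
    ∃ C > (0 : ℝ), ∀ u₀ : SchwartzMap ℝ ℂ,
      mixedLpLq 4 ∞ (DSgrpPa ν μ (-(1 / 4)) (fun x => u₀ x)) ≤
        ENNReal.ofReal C * eLpNorm (fun x => u₀ x) 2 volume := by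
  refine ⟨√(1456 * (2 * π)), by positivity, fun u₀ => ?_⟩
  set A : ℝ := ∫ x, ‖u₀ x‖ ^ 2 with hA
  have hA0 : 0 ≤ A := integral_nonneg fun x => by positivity
  set v : ℝ → ℂ := FT fun x => u₀ x with hv
  have hvi : Integrable v := integrable_FT u₀
  have hW := (lintegral_enorm_FT_sq u₀).le
  have hmax : ∫⁻ x, eLpNorm (highFreqSol ν μ v x) ∞ volume ^ 4 ≤
      ENNReal.ofReal ((1456 * (2 * π * A)) ^ 2) :=
    lintegral_eLpNorm_top_pow_four_le (continuous_highFreqSol ν μ hvi) fun τ hτ R =>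
      lintegral_highFreqSol_pow_four_le hμ hvi hW hτ R
  have hlt : ∫⁻ x, eLpNorm (DSgrpPa ν μ (-(1 / 4)) (fun x => u₀ x) x) ∞ volume ^ 4 ≤
      ENNReal.ofReal ((1456 * (2 * π * A)) ^ 2) :=
    (lintegral_mono fun x => pow_le_pow_left'
      (eLpNorm_mono fun t => norm_DSgrpPa_le ν μ (fun x => u₀ x) x t) 4).trans hmax
  unfold mixedLpLq
  rw [if_neg (by norm_num), eLpNorm_two_sq, ← ENNReal.ofReal_mul (by positivity),
    ← Real.sqrt_mul (by positivity)]
  simp only [ENNReal.toReal_ofNat]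
  calc _ ≤ ENNReal.ofReal ((1456 * (2 * π * A)) ^ 2) ^ (1 / 4 : ℝ) := by
        refine ENNReal.rpow_le_rpow (le_trans (le_of_eq (lintegral_congr fun x => ?_)) hlt)
          (by norm_num)
        exact_mod_cast ENNReal.rpow_natCast _ 4
    _ = ENNReal.ofReal (√(1456 * (2 * π) * A)) := by
        rw [ENNReal.ofReal_rpow_of_nonneg (by positivity) (by norm_num), Real.sqrt_eq_rpow,
          ← Real.rpow_natCast, ← Real.rpow_mul (by positivity)]
        norm_num [mul_assoc]
    _ ≤ _ := le_rfl
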